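/- Let Φ be a Young function satisfying the Δ2-condition. For a convex set C ⊂ L_{Φ*} the following are equivalent: (1) C is σ(L_{Φ*},L_Φ)-closed; (2) C is sequentially σ(L_{Φ*},L_Φ)-closed; (3) for each λ > 0 the set C ∩ λB_{Φ*} is closed for the topology of convergence in probability, i.e. ξ_n ∈ C for all n, ξ_n → ξ in probability and sup_n ‖ξ_n‖_{Φ*} < ∞ imply ξ ∈ C. -/

import Mathlib

open MeasureTheory Filter Topology Set
open scoped ENNReal

noncomputable section

namespace OrliczPaper

variable {Ω : Type*} [MeasurableSpace Ω]

/-- A (finite, coercive) Young function: an even convex function with `Φ 0 = 0`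
and `Φ x / x → ∞` as `x → ∞`. -/
structure IsYoung (Φ : ℝ → ℝ) : Prop where
  even : ∀ x, Φ (-x) = Φ x
  convexOn : ConvexOn ℝ Set.univ Φ
  map_zero : Φ 0 = 0
  coercive : Tendsto (fun x => Φ x / x) atTop atTop

/-- The Δ₂-condition: `limsup_{x→∞} Φ(2x)/Φ(x) < ∞`, i.e. `Φ(2x) ≤ C Φ(x)`
for all large `x`. -/
def Delta2 (Φ : ℝ → ℝ) : Prop :=
  ∃ C x₀ : ℝ, ∀ x ≥ x₀, Φ (2 * x) ≤ C * Φ x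

/-- The conjugate Young function `Φ*(y) = sup_x (x y − Φ x)`. -/
def conj (Φ : ℝ → ℝ) (y : ℝ) : ℝ := ⨆ x : ℝ, x * y - Φ x

variable (P : Measure Ω)

/-- Membership in the Orlicz space `L_Φ`: a measurable function with
`E[Φ(l ξ)] < ∞` for some `l > 0`. -/
def MemOrlicz (Φ : ℝ → ℝ) (f : Ω → ℝ) : Prop :=
  Measurable f ∧ ∃ l : ℝ, 0 < l ∧ ∫⁻ ω, ENNReal.ofReal (Φ (l * f ω)) ∂P < ⊤

/-- The Orlicz space `L_Φ`, as a set of (everywhere defined) measurable functions. -/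
def Orlicz (Φ : ℝ → ℝ) : Set (Ω → ℝ) := {f | MemOrlicz P Φ f}

/-- The Luxemburg norm `‖f‖_Φ = inf {l > 0 : E[Φ(f/l)] ≤ 1}`. -/
def luxNorm (Φ : ℝ → ℝ) (f : Ω → ℝ) : ℝ :=
  sInf {l : ℝ | 0 < l ∧ ∫⁻ ω, ENNReal.ofReal (Φ (f ω / l)) ∂P ≤ 1}

/-- The Orlicz (dual) norm `‖f‖_{(Φ*)} = sup {E[g f] : E[Φ(g)] ≤ 1}`
(the Young function `Φ` here is the one of the *predual*). -/
def orliczNorm (Φ : ℝ → ℝ) (f : Ω → ℝ) : ℝ :=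
  sSup {r : ℝ | ∃ g : Ω → ℝ, Measurable g ∧
    (∫⁻ ω, ENNReal.ofReal (Φ (g ω)) ∂P) ≤ 1 ∧ r = ∫ ω, g ω * f ω ∂P}

/-- The bilinear pairing `⟨f, g⟩ = E[f g]`. -/
def pairing (f g : Ω → ℝ) : ℝ := ∫ ω, f ω * g ω ∂P

/-- The weak topology `σ(E, F)` on `E` induced by the pairing with `F`. -/
def weakT (E F : Set (Ω → ℝ)) : TopologicalSpace E :=
  TopologicalSpace.induced
    (fun ξ : E => fun η : F => pairing P (ξ : Ω → ℝ) (η : Ω → ℝ)) inferInstance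

/-- The absolutely convex (convex and balanced) `σ(F,E)`-compact subsets of `F`. -/
def dualSets (E F : Set (Ω → ℝ)) : Set (Set F) :=
  {A | Convex ℝ (Subtype.val '' A) ∧ Balanced ℝ (Subtype.val '' A) ∧
    @IsCompact _ (weakT P F E) A}

/-- The Mackey topology `τ(E, F)`: the topology on `E` of uniform convergence on
absolutely convex `σ(F,E)`-compact subsets of `F`. -/
def mackeyT (E F : Set (Ω → ℝ)) : TopologicalSpace E :=
  TopologicalSpace.induced
    (fun ξ : E => UniformOnFun.ofFun (dualSets P E F)
      (fun η : F => pairing P (ξ : Ω → ℝ) (η : Ω → ℝ)))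
    inferInstance

/-- A distance generating the topology of convergence in `P`-probability. -/
def probDist (f g : Ω → ℝ) : ℝ := ∫ ω, min |f ω - g ω| 1 ∂P

/-- The topology of convergence in probability, restricted to `E ⊆ L₀`. -/
def probT (E : Set (Ω → ℝ)) : TopologicalSpace E :=
  TopologicalSpace.generateFrom
    {U | ∃ f : E, ∃ ε : ℝ, 0 < ε ∧ U = {g : E | probDist P (f : Ω → ℝ) (g : Ω → ℝ) < ε}}

/-- `L_∞`: essentially bounded measurable functions. -/
def Linf : Set (Ω → ℝ) := {f | Measurable f ∧ ∃ C : ℝ, ∀ᵐ ω ∂P, |f ω| ≤ C}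

/-- `L_1`: integrable measurable functions. -/
def L1 : Set (Ω → ℝ) := {f | Measurable f ∧ Integrable f P}

/-- The essential supremum norm. -/
def linfNorm (f : Ω → ℝ) : ℝ := sInf {C : ℝ | 0 ≤ C ∧ ∀ᵐ ω ∂P, |f ω| ≤ C}

/-- Uniform integrability of a set of functions:
`sup_{f ∈ A} E[|f| 1_{|f| > N}] → 0`. -/
def UnifInt (A : Set (Ω → ℝ)) : Prop :=
  Tendsto (fun N : ℕ => ⨆ f ∈ A, ∫⁻ ω in {ω | (N : ℝ) < |f ω|}, ENNReal.ofReal |f ω| ∂P)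
    atTop (𝓝 0)

/-- Uniform integrability of a sequence of functions. -/
def UnifIntSeq (g : ℕ → Ω → ℝ) : Prop :=
  Tendsto (fun N : ℕ => ⨆ n, ∫⁻ ω in {ω | (N : ℝ) < |g n ω|}, ENNReal.ofReal |g n ω| ∂P)
    atTop (𝓝 0)

/-- The Cesàro means of a sequence of functions: `cesaro ξ N` is the average of
`ξ 0, …, ξ N`. -/
def cesaro (ξ : ℕ → Ω → ℝ) (N : ℕ) : Ω → ℝ :=
  fun ω => (∑ i ∈ Finset.range (N + 1), ξ i ω) / (N + 1)

/-- `sup_n |ξ n| ∈ L_Φ` (order boundedness of the sequence `ξ` in `L_Φ`). -/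
def supMem (Φ : ℝ → ℝ) (ξ : ℕ → Ω → ℝ) : Prop :=
  (∀ᵐ ω ∂P, BddAbove (Set.range fun n => |ξ n ω|)) ∧
    MemOrlicz P Φ (fun ω => ⨆ n, |ξ n ω|)

/-- `ξb` is a sequence of forward convex combinations of `ξ`:
`ξb n ∈ conv (ξ k ; k ≥ n)`. -/
def FwdConvComb (ξ ξb : ℕ → Ω → ℝ) : Prop :=
  ∀ n, ξb n ∈ convexHull ℝ {g : Ω → ℝ | ∃ k ≥ n, g = ξ k}

/-- The left derivative of a convex function. -/
def leftDeriv (Φ : ℝ → ℝ) (y : ℝ) : ℝ :=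
  ⨆ h : {h : ℝ // 0 < h}, (Φ y - Φ (y - (h : ℝ))) / (h : ℝ)

/-- `p_Φ(x) = sup_{y > x} y Φ'(y) / Φ(y)`. -/
def pPhiAt (Φ : ℝ → ℝ) (x : ℝ) : ℝ≥0∞ :=
  ⨆ y : {y : ℝ // x < y}, ENNReal.ofReal ((y : ℝ) * leftDeriv Φ (y : ℝ) / Φ (y : ℝ))

/-- `p_Φ = inf_{x ≥ 0} p_Φ(x)`. -/
def pPhi (Φ : ℝ → ℝ) : ℝ≥0∞ := ⨅ x : {x : ℝ // 0 ≤ x}, pPhiAt Φ x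

/-- `q_Φ = p_Φ / (p_Φ − 1)` (with `1/0 = ∞`). -/
def qPhi (Φ : ℝ → ℝ) : ℝ≥0∞ := pPhi Φ / (pPhi Φ - 1)

end OrliczPaper

namespace OrliczPaper

/-! ### Even convex functions vanishing at the origin -/

/-- An even convex function on `ℝ` vanishing at `0`, without any growth condition. -/
structure IsEvenConvex (G : ℝ → ℝ) : Prop where
  even : ∀ x, G (-x) = G x
  convexOn : ConvexOn ℝ Set.univ G
  map_zero : G 0 = 0

theorem IsYoung.isEvenConvex {Φ : ℝ → ℝ} (h : IsYoung Φ) : IsEvenConvex Φ :=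
  ⟨h.even, h.convexOn, h.map_zero⟩

namespace IsEvenConvex

variable {G : ℝ → ℝ}

theorem map_abs (h : IsEvenConvex G) (x : ℝ) : G |x| = G x := by
  rcases abs_choice x with hx | hx <;> simp [hx, h.even]

theorem combo_le (h : IsEvenConvex G) (x y : ℝ) {a b : ℝ} (ha : 0 ≤ a) (hb : 0 ≤ b)
    (hab : a + b = 1) : G (a * x + b * y) ≤ a * G x + b * G y := by
  simpa using h.convexOn.2 (mem_univ x) (mem_univ y) ha hb hab

theorem nonneg (h : IsEvenConvex G) (x : ℝ) : 0 ≤ G x := by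
  have := h.combo_le x (-x) (a := 1 / 2) (b := 1 / 2) (by norm_num) (by norm_num) (by norm_num)
  rw [h.even, show 1 / 2 * x + 1 / 2 * -x = 0 by ring, h.map_zero] at this
  linarith

theorem smul_le (h : IsEvenConvex G) {t : ℝ} (ht : 0 ≤ t) (ht1 : t ≤ 1) (x : ℝ) :
    G (t * x) ≤ t * G x := by
  have := h.combo_le x 0 ht (sub_nonneg.2 ht1) (by ring)
  simpa [h.map_zero] using this

theorem mono (h : IsEvenConvex G) {x y : ℝ} (hxy : |x| ≤ |y|) : G x ≤ G y := by
  rw [← h.map_abs x, ← h.map_abs y]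
  rcases (abs_nonneg y).eq_or_lt with hy | hy
  · rw [← hy] at hxy ⊢
    rw [le_antisymm hxy (abs_nonneg x)]
  · have h1 : |x| / |y| ≤ 1 := div_le_one_of_le₀ hxy hy.le
    have := h.smul_le (div_nonneg (abs_nonneg x) hy.le) h1 |y|
    rw [div_mul_cancel₀ _ hy.ne'] at this
    nlinarith [h.nonneg |y|]

theorem continuous (h : IsEvenConvex G) : Continuous G :=
  continuousOn_univ.1 (h.convexOn.continuousOn isOpen_univ)

theorem measurable (h : IsEvenConvex G) : Measurable G := h.continuous.measurable

end IsEvenConvex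

/-! ### The conjugate function and its truncations -/

section Conj

variable {Φ : ℝ → ℝ}

theorem IsYoung.bddAbove_conj (h : IsYoung Φ) (y : ℝ) :
    BddAbove (range fun x : ℝ => x * y - Φ x) := by
  obtain ⟨A, hA⟩ := (h.coercive.eventually_ge_atTop |y|).exists_forall_of_atTop
  refine ⟨max A 1 * |y|, ?_⟩
  rintro _ ⟨x, rfl⟩
  have h1 : x * y ≤ |x| * |y| := by rw [← abs_mul]; exact le_abs_self _
  have h0 := h.isEvenConvex.nonneg x
  rcases le_total |x| (max A 1) with hx | hx
  · have := mul_le_mul_of_nonneg_right hx (abs_nonneg y)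
    simp only; linarith
  · have hx0 : 0 < |x| := lt_of_lt_of_le one_pos ((le_max_right A 1).trans hx)
    have h2 := hA |x| ((le_max_left A 1).trans hx)
    rw [le_div_iff₀ hx0, h.isEvenConvex.map_abs] at h2
    have : 0 ≤ max A 1 * |y| := by positivity
    simp only; linarith

theorem IsYoung.mul_sub_le_conj (h : IsYoung Φ) (x y : ℝ) : x * y - Φ x ≤ conj Φ y :=
  le_ciSup (h.bddAbove_conj y) x

/-- Young's inequality. -/
theorem IsYoung.abs_mul_le (h : IsYoung Φ) (x y : ℝ) : |x * y| ≤ Φ x + conj Φ y := by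
  have h1 := h.mul_sub_le_conj x y
  have h2 := h.mul_sub_le_conj (-x) y
  rw [h.even] at h2
  rw [abs_le]
  constructor <;> linarith

/-- A supremum of the affine functions `y ↦ x y - Φ x` over a symmetric set of slopes is an even
convex function vanishing at `0`. -/
theorem isEvenConvex_iSup (h : IsYoung Φ) {S : Set ℝ} (h0 : (0 : ℝ) ∈ S)
    (hS : ∀ x ∈ S, -x ∈ S) :
    IsEvenConvex fun y => ⨆ x : S, (x : ℝ) * y - Φ x := by
  have hb : ∀ y, BddAbove (range fun x : S => (x : ℝ) * y - Φ x) := fun y =>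
    (h.bddAbove_conj y).mono (by rintro _ ⟨x, rfl⟩; exact ⟨x, rfl⟩)
  have : Nonempty S := ⟨⟨0, h0⟩⟩
  refine ⟨fun y => ?_, ⟨convex_univ, fun y _ z _ a b ha hb' hab => ?_⟩, ?_⟩
  · refine le_antisymm (ciSup_le fun x => ?_) (ciSup_le fun x => ?_)
    · have := le_ciSup (hb y) ⟨-x, hS x x.2⟩
      simp only [h.even] at this
      linarith
    · have := le_ciSup (hb (-y)) ⟨-x, hS x x.2⟩
      simp only [h.even] at this
      linarith
  · refine ciSup_le fun x => ?_
    have h1 := mul_le_mul_of_nonneg_left (le_ciSup (hb y) x) ha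
    have h2 := mul_le_mul_of_nonneg_left (le_ciSup (hb z) x) hb'
    simp only [smul_eq_mul] at *
    have : (x : ℝ) * (a * y + b * z) - Φ x =
        a * (x * y - Φ x) + b * (x * z - Φ x) := by
      linear_combination (Φ x) * hab
    linarith
  · refine le_antisymm (ciSup_le fun x => ?_) ?_
    · have := h.isEvenConvex.nonneg x
      simpa using this
    · simpa [h.map_zero] using le_ciSup (hb 0) ⟨0, h0⟩

theorem IsYoung.isEvenConvex_conj (h : IsYoung Φ) : IsEvenConvex (conj Φ) := by
  have := isEvenConvex_iSup h (S := Set.univ) (mem_univ 0) (fun _ _ => mem_univ _)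
  convert this using 1
  ext y
  exact ((Equiv.Set.univ ℝ).iSup_comp (g := fun x => x * y - Φ x)).symm

/-- The conjugate truncated at slope `k`: `sup_{|x| ≤ k} (x y - Φ x)`. -/
def truncConj (Φ : ℝ → ℝ) (k : ℕ) (y : ℝ) : ℝ := ⨆ x : Icc (-(k : ℝ)) k, (x : ℝ) * y - Φ x

theorem IsYoung.isEvenConvex_truncConj (h : IsYoung Φ) (k : ℕ) :
    IsEvenConvex (truncConj Φ k) :=
  isEvenConvex_iSup h (by simp) fun x hx => ⟨by linarith [hx.2], by linarith [hx.1]⟩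

theorem IsYoung.le_truncConj (h : IsYoung Φ) {k : ℕ} {x : ℝ} (hx : |x| ≤ k) (y : ℝ) :
    x * y - Φ x ≤ truncConj Φ k y :=
  le_ciSup (f := fun x : Icc (-(k : ℝ)) k => (x : ℝ) * y - Φ x)
    ((h.bddAbove_conj y).mono (by rintro _ ⟨x, rfl⟩; exact ⟨x, rfl⟩)) ⟨x, abs_le.1 hx⟩

theorem truncConj_le {k : ℕ} {y c : ℝ} (hc : ∀ x : ℝ, |x| ≤ k → x * y - Φ x ≤ c) :
    truncConj Φ k y ≤ c := by
  have : Nonempty (Icc (-(k : ℝ)) k) := ⟨⟨0, by simp⟩⟩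
  exact ciSup_le fun x => hc x (abs_le.2 x.2)

theorem IsYoung.truncConj_le_conj (h : IsYoung Φ) (k : ℕ) (y : ℝ) :
    truncConj Φ k y ≤ conj Φ y :=
  truncConj_le fun x _ => h.mul_sub_le_conj x y

theorem IsYoung.truncConj_mono (h : IsYoung Φ) (y : ℝ) : Monotone fun k => truncConj Φ k y :=
  fun _ _ hkm => truncConj_le fun _ hx => h.le_truncConj (hx.trans (by exact_mod_cast hkm)) y

theorem IsYoung.truncConj_le_mul (h : IsYoung Φ) (k : ℕ) (y : ℝ) :
    truncConj Φ k y ≤ k * |y| :=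
  truncConj_le fun x hx => by
    have h1 : x * y ≤ |x| * |y| := by rw [← abs_mul]; exact le_abs_self _
    have h2 := mul_le_mul_of_nonneg_right hx (abs_nonneg y)
    linarith [h.isEvenConvex.nonneg x]

theorem IsYoung.tendsto_truncConj (h : IsYoung Φ) (y : ℝ) :
    Tendsto (fun k => truncConj Φ k y) atTop (𝓝 (conj Φ y)) := by
  refine tendsto_atTop_isLUB (h.truncConj_mono y) ⟨?_, fun c hc => ciSup_le fun x => ?_⟩
  · rintro _ ⟨k, rfl⟩
    exact h.truncConj_le_conj k y
  · obtain ⟨k, hk⟩ := exists_nat_ge |x|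
    exact (h.le_truncConj hk y).trans (hc ⟨k, rfl⟩)

theorem IsYoung.conj_div_le (h : IsYoung Φ) (y : ℝ) : conj Φ (Φ y / y) ≤ Φ y := by
  refine ciSup_le fun x => ?_
  have hy := h.isEvenConvex.nonneg y
  have hx := h.isEvenConvex.nonneg x
  rcases eq_or_ne y 0 with rfl | hy0
  · simpa [h.map_zero] using hx
  have hy1 : 0 < |y| := abs_pos.2 hy0
  have h1 : x * (Φ y / y) ≤ |x| * (Φ y / |y|) := by
    refine (le_abs_self _).trans ?_
    rw [abs_mul, abs_div, abs_of_nonneg hy]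
  rcases le_total |x| |y| with hxy | hxy
  · have : |x| * (Φ y / |y|) ≤ Φ y := by
      rw [← mul_div_assoc, div_le_iff₀ hy1]
      nlinarith
    linarith
  · have hx1 := hy1.trans_le hxy
    have := h.isEvenConvex.smul_le (div_nonneg hy1.le hx1.le) (div_le_one_of_le₀ hxy hx1.le) |x|
    rw [div_mul_cancel₀ _ hx1.ne', h.isEvenConvex.map_abs, h.isEvenConvex.map_abs] at this
    have h2 : |x| * (Φ y / |y|) ≤ Φ x := by
      calc |x| * (Φ y / |y|) ≤ |x| * (|y| / |x| * Φ x / |y|) := by gcongr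
        _ = Φ x := by field_simp
    linarith

end Conj

/-! ### Modular balls -/

section Ball

variable {Ω : Type*} [MeasurableSpace Ω] {P : Measure Ω} {G : ℝ → ℝ}

/-- The measurable functions `ξ` with `E[G(ξ / l)] ≤ 1`. -/
def modBall (P : Measure Ω) (G : ℝ → ℝ) (l : ℝ) : Set (Ω → ℝ) :=
  {ξ | Measurable ξ ∧ ∫⁻ ω, ENNReal.ofReal (G (ξ ω / l)) ∂P ≤ 1}

theorem modBall_of_abs_le (hG : IsEvenConvex G) {l m : ℝ} {ξ ζ : Ω → ℝ} (hξ : ξ ∈ modBall P G l)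
    (hζ : Measurable ζ) (h : ∀ ω, |ζ ω / m| ≤ |ξ ω / l|) : ζ ∈ modBall P G m :=
  ⟨hζ, (lintegral_mono fun ω => ENNReal.ofReal_le_ofReal (hG.mono (h ω))).trans hξ.2⟩

theorem modBall_mono (hG : IsEvenConvex G) {l m : ℝ} (hl : 0 < l) (hlm : l ≤ m) :
    modBall P G l ⊆ modBall P G m := fun ξ hξ =>
  modBall_of_abs_le hG hξ hξ.1 fun ω => by
    rw [abs_div, abs_div, abs_of_pos hl, abs_of_pos (hl.trans_le hlm)]
    gcongr

theorem modBall_add (hG : IsEvenConvex G) {l m : ℝ} (hl : 0 < l) (hm : 0 < m) {ξ ζ : Ω → ℝ}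
    (hξ : ξ ∈ modBall P G l) (hζ : ζ ∈ modBall P G m) : ξ + ζ ∈ modBall P G (l + m) := by
  refine ⟨hξ.1.add hζ.1, ?_⟩
  have hs : 0 < l + m := add_pos hl hm
  have ha : 0 ≤ l / (l + m) := by positivity
  have hb : 0 ≤ m / (l + m) := by positivity
  have hab : l / (l + m) + m / (l + m) = 1 := by rw [← add_div, div_self hs.ne']
  have hm1 : Measurable fun ω => ENNReal.ofReal (G (ξ ω / l)) :=
    (hG.measurable.comp (hξ.1.div_const l)).ennreal_ofReal
  have hm2 : Measurable fun ω => ENNReal.ofReal (G (ζ ω / m)) :=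
    (hG.measurable.comp (hζ.1.div_const m)).ennreal_ofReal
  calc ∫⁻ ω, ENNReal.ofReal (G ((ξ + ζ) ω / (l + m))) ∂P
      ≤ ∫⁻ ω, (ENNReal.ofReal (l / (l + m)) * ENNReal.ofReal (G (ξ ω / l)) +
          ENNReal.ofReal (m / (l + m)) * ENNReal.ofReal (G (ζ ω / m))) ∂P := by
        refine lintegral_mono fun ω => ?_
        simp only
        rw [← ENNReal.ofReal_mul ha, ← ENNReal.ofReal_mul hb,
          ← ENNReal.ofReal_add (mul_nonneg ha (hG.nonneg _)) (mul_nonneg hb (hG.nonneg _))]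
        refine ENNReal.ofReal_le_ofReal ?_
        have := hG.combo_le (ξ ω / l) (ζ ω / m) ha hb hab
        convert this using 2
        simp only [Pi.add_apply]
        field_simp
    _ = ENNReal.ofReal (l / (l + m)) * ∫⁻ ω, ENNReal.ofReal (G (ξ ω / l)) ∂P +
          ENNReal.ofReal (m / (l + m)) * ∫⁻ ω, ENNReal.ofReal (G (ζ ω / m)) ∂P := by
        rw [lintegral_add_left (hm1.const_mul _), lintegral_const_mul _ hm1,
          lintegral_const_mul _ hm2]
    _ ≤ ENNReal.ofReal (l / (l + m)) * 1 + ENNReal.ofReal (m / (l + m)) * 1 := by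
        gcongr
        · exact hξ.2
        · exact hζ.2
    _ = 1 := by rw [mul_one, mul_one, ← ENNReal.ofReal_add ha hb, hab, ENNReal.ofReal_one]

theorem modBall_smul (hG : IsEvenConvex G) {l c m : ℝ} (hm : 0 < m) (hl : 0 < l)
    (hc : |c| * l ≤ m) {ξ : Ω → ℝ} (hξ : ξ ∈ modBall P G l) : c • ξ ∈ modBall P G m := by
  refine modBall_of_abs_le hG hξ (hξ.1.const_smul c) fun ω => ?_
  simp only [Pi.smul_apply, smul_eq_mul]
  rw [abs_div, abs_div, abs_mul, abs_of_pos hl, abs_of_pos hm, div_le_div_iff₀ hm hl]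
  nlinarith [abs_nonneg (ξ ω)]

theorem convex_modBall (hG : IsEvenConvex G) {l : ℝ} (hl : 0 < l) :
    Convex ℝ (modBall P G l) := by
  refine convex_iff_forall_pos.2 fun ξ hξ ζ hζ a b ha hb hab => ?_
  have h1 := modBall_smul hG (mul_pos ha hl) hl (by rw [abs_of_pos ha]) hξ
  have h2 := modBall_smul hG (mul_pos hb hl) hl (by rw [abs_of_pos hb]) hζ
  have := modBall_add hG (mul_pos ha hl) (mul_pos hb hl) h1 h2
  rwa [← add_mul, hab, one_mul] at this

theorem modBall_of_tendsto (hG : IsEvenConvex G) {l : ℝ} {ξ : ℕ → Ω → ℝ} {ξ₀ : Ω → ℝ}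
    (hξ : ∀ n, ξ n ∈ modBall P G l) (hξ₀ : Measurable ξ₀)
    (h : ∀ᵐ ω ∂P, Tendsto (fun n => ξ n ω) atTop (𝓝 (ξ₀ ω))) : ξ₀ ∈ modBall P G l := by
  refine ⟨hξ₀, ?_⟩
  calc ∫⁻ ω, ENNReal.ofReal (G (ξ₀ ω / l)) ∂P
      = ∫⁻ ω, liminf (fun n => ENNReal.ofReal (G (ξ n ω / l))) atTop ∂P := by
        refine lintegral_congr_ae ?_
        filter_upwards [h] with ω hω
        exact (ENNReal.tendsto_ofReal
          ((hG.continuous.tendsto _).comp (hω.div_const l))).liminf_eq.symm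
    _ ≤ liminf (fun n => ∫⁻ ω, ENNReal.ofReal (G (ξ n ω / l)) ∂P) atTop :=
        lintegral_liminf_le fun n =>
          (hG.measurable.comp ((hξ n).1.div_const l)).ennreal_ofReal
    _ ≤ 1 := by
        refine (liminf_le_liminf (Eventually.of_forall fun n => (hξ n).2)).trans ?_
        simp

theorem exists_modBall (hG : IsEvenConvex G) {ξ : Ω → ℝ} (hξ : MemOrlicz P G ξ) :
    ∃ l, 0 < l ∧ ξ ∈ modBall P G l := by
  obtain ⟨hm, l, hl, hfin⟩ := hξ
  set I := ∫⁻ ω, ENNReal.ofReal (G (l * ξ ω)) ∂P with hI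
  set t : ℝ := (1 + I.toReal)⁻¹ with ht
  have hI0 : 0 ≤ I.toReal := ENNReal.toReal_nonneg
  have ht0 : 0 < t := by positivity
  have ht1 : t ≤ 1 := inv_le_one_of_one_le₀ (by linarith)
  refine ⟨(t * l)⁻¹, by positivity, hm, ?_⟩
  calc ∫⁻ ω, ENNReal.ofReal (G (ξ ω / (t * l)⁻¹)) ∂P
      ≤ ∫⁻ ω, ENNReal.ofReal t * ENNReal.ofReal (G (l * ξ ω)) ∂P := by
        refine lintegral_mono fun ω => ?_
        simp only
        rw [← ENNReal.ofReal_mul ht0.le]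
        refine ENNReal.ofReal_le_ofReal ?_
        convert hG.smul_le ht0.le ht1 (l * ξ ω) using 2
        rw [div_inv_eq_mul]; ring
    _ = ENNReal.ofReal t * I := by
        exact lintegral_const_mul _ (hG.measurable.comp (hm.const_mul l)).ennreal_ofReal
    _ = ENNReal.ofReal (t * I.toReal) := by
        rw [ENNReal.ofReal_mul ht0.le, ENNReal.ofReal_toReal hfin.ne]
    _ ≤ 1 := by
        rw [ENNReal.ofReal_le_one, ht, inv_mul_le_iff₀ (by positivity)]
        linarith

theorem memOrlicz_of_modBall {l : ℝ} (hl : 0 < l) {ξ : Ω → ℝ}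
    (hξ : ξ ∈ modBall P G l) : MemOrlicz P G ξ :=
  ⟨hξ.1, l⁻¹, inv_pos.2 hl, by
    simpa only [inv_mul_eq_div] using hξ.2.trans_lt ENNReal.one_lt_top⟩

theorem luxNorm_le {l : ℝ} (hl : 0 < l) {ξ : Ω → ℝ} (hξ : ξ ∈ modBall P G l) :
    luxNorm P G ξ ≤ l :=
  csInf_le ⟨0, fun _ h => h.1.le⟩ ⟨hl, hξ.2⟩

theorem modBall_of_luxNorm_lt (hG : IsEvenConvex G) {l : ℝ} {ξ : Ω → ℝ} (hξ : MemOrlicz P G ξ)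
    (h : luxNorm P G ξ < l) : ξ ∈ modBall P G l := by
  obtain ⟨m, hm, hξm⟩ := exists_modBall hG hξ
  obtain ⟨r, ⟨hr, hr1⟩, hrl⟩ := exists_lt_of_csInf_lt
    (show Set.Nonempty {r : ℝ | 0 < r ∧ ∫⁻ ω, ENNReal.ofReal (G (ξ ω / r)) ∂P ≤ 1} from
      ⟨m, hm, hξm.2⟩) h
  exact modBall_mono hG hr hrl.le ⟨hξ.1, hr1⟩

/-- The Orlicz space as a linear subspace of the space of all functions. -/
def orliczSubmodule (P : Measure Ω) (hG : IsEvenConvex G) : Submodule ℝ (Ω → ℝ) where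
  carrier := Orlicz P G
  zero_mem' := memOrlicz_of_modBall one_pos ⟨measurable_const, by simp [hG.map_zero]⟩
  add_mem' := fun hξ hζ => by
    obtain ⟨l, hl, hξ⟩ := exists_modBall hG hξ
    obtain ⟨m, hm, hζ⟩ := exists_modBall hG hζ
    exact memOrlicz_of_modBall (add_pos hl hm) (modBall_add hG hl hm hξ hζ)
  smul_mem' := fun c ξ hξ => by
    obtain ⟨l, hl, hξ⟩ := exists_modBall hG hξ
    have : 0 < |c| * l + l := by positivity
    exact memOrlicz_of_modBall this (modBall_smul hG this hl (by linarith) hξ)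

end Ball

/-! ### Bounded almost sure convergence and the pairing -/

section Pairing

variable {Ω : Type*} [MeasurableSpace Ω] {P : Measure Ω} {Φ : ℝ → ℝ}

theorem integrable_mul (hΦ : IsYoung Φ) {ξ η : Ω → ℝ} (hξ : MemOrlicz P (conj Φ) ξ)
    (hη : MemOrlicz P Φ η) : Integrable (fun ω => ξ ω * η ω) P := by
  obtain ⟨l, hl, hξ⟩ := exists_modBall hΦ.isEvenConvex_conj hξ
  obtain ⟨m, hm, hη⟩ := exists_modBall hΦ.isEvenConvex hη
  have h1 : Integrable (fun ω => Φ (η ω / m)) P := by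
    refine ⟨(hΦ.isEvenConvex.measurable.comp (hη.1.div_const m)).aestronglyMeasurable, ?_⟩
    rw [hasFiniteIntegral_iff_ofReal (ae_of_all _ fun ω => hΦ.isEvenConvex.nonneg _)]
    exact hη.2.trans_lt ENNReal.one_lt_top
  have h2 : Integrable (fun ω => conj Φ (ξ ω / l)) P := by
    refine ⟨(hΦ.isEvenConvex_conj.measurable.comp (hξ.1.div_const l)).aestronglyMeasurable, ?_⟩
    rw [hasFiniteIntegral_iff_ofReal (ae_of_all _ fun ω => hΦ.isEvenConvex_conj.nonneg _)]
    exact hξ.2.trans_lt ENNReal.one_lt_top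
  refine ((h1.add h2).const_mul (l * m)).mono' (hξ.1.mul hη.1).aestronglyMeasurable
    (ae_of_all _ fun ω => ?_)
  have := mul_le_mul_of_nonneg_left (hΦ.abs_mul_le (η ω / m) (ξ ω / l)) (mul_pos hl hm).le
  rw [← abs_of_pos (mul_pos hl hm), ← abs_mul, abs_of_pos (mul_pos hl hm)] at this
  have h3 : l * m * (η ω / m * (ξ ω / l)) = ξ ω * η ω := by field_simp
  rw [h3] at this
  rw [Real.norm_eq_abs]
  exact this

theorem tendsto_lintegral_mul (hΦ : IsYoung Φ) {η : Ω → ℝ} (hη : Measurable η)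
    (hηk : ∀ k : ℕ, ∫⁻ ω, ENNReal.ofReal (Φ (k * η ω)) ∂P < ⊤) {l : ℝ} (hl : 0 < l)
    {ζ : ℕ → Ω → ℝ} (hζ : ∀ n, ζ n ∈ modBall P (conj Φ) l)
    (h : ∀ᵐ ω ∂P, Tendsto (fun n => ζ n ω) atTop (𝓝 0)) :
    Tendsto (fun n => ∫⁻ ω, ENNReal.ofReal |ζ n ω * η ω| ∂P) atTop (𝓝 0) := by
  rw [ENNReal.tendsto_nhds_zero]
  intro ε hε
  have hε2 : 0 < ε / 2 := ENNReal.half_pos hε.ne'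
  obtain ⟨k, hk0, hk⟩ : ∃ k : ℕ, 0 < k ∧ ENNReal.ofReal (l / k) < ε / 2 := by
    have h0 : Tendsto (fun k : ℕ => ENNReal.ofReal (l / k)) atTop (𝓝 0) := by
      simpa using ENNReal.tendsto_ofReal (tendsto_const_div_atTop_nhds_zero_nat l)
    exact ((eventually_gt_atTop 0).and (h0.eventually_lt_const hε2)).exists
  have hk' : (0 : ℝ) < k := by exact_mod_cast hk0
  have hlk : 0 < l / k := by positivity
  have hmζ : ∀ n, Measurable fun ω => conj Φ (ζ n ω / l) := fun n =>
    hΦ.isEvenConvex_conj.measurable.comp ((hζ n).1.div_const l)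
  set F : ℕ → Ω → ℝ≥0∞ := fun n ω =>
    ENNReal.ofReal (|ζ n ω * η ω| - l / k * conj Φ (ζ n ω / l)) with hF
  have hFm : ∀ n, Measurable (F n) := fun n =>
    (((hζ n).1.mul hη).abs.sub ((hmζ n).const_mul _)).ennreal_ofReal
  have hFt : Tendsto (fun n => ∫⁻ ω, F n ω ∂P) atTop (𝓝 (∫⁻ _, 0 ∂P)) := by
    refine tendsto_lintegral_of_dominated_convergence
      (fun ω => ENNReal.ofReal (l / k) * ENNReal.ofReal (Φ (k * η ω))) hFm (fun n => ?_) ?_ ?_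
    · refine ae_of_all _ fun ω => ?_
      simp only [hF]
      rw [← ENNReal.ofReal_mul hlk.le]
      refine ENNReal.ofReal_le_ofReal ?_
      have := mul_le_mul_of_nonneg_left (hΦ.abs_mul_le (k * η ω) (ζ n ω / l)) hlk.le
      rw [← abs_of_pos hlk, ← abs_mul, abs_of_pos hlk] at this
      have h2 : l / k * (k * η ω * (ζ n ω / l)) = ζ n ω * η ω := by field_simp
      rw [h2] at this
      linarith
    · rw [lintegral_const_mul' _ _ ENNReal.ofReal_ne_top]
      exact ENNReal.mul_ne_top ENNReal.ofReal_ne_top (hηk k).ne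
    · filter_upwards [h] with ω hω
      have h1 : Tendsto (fun n => ENNReal.ofReal |ζ n ω * η ω|) atTop (𝓝 0) := by
        simpa using ENNReal.tendsto_ofReal (hω.mul_const (η ω)).abs
      refine tendsto_of_tendsto_of_tendsto_of_le_of_le tendsto_const_nhds h1
        (fun n => zero_le) fun n => ENNReal.ofReal_le_ofReal ?_
      have := mul_nonneg hlk.le (hΦ.isEvenConvex_conj.nonneg (ζ n ω / l))
      linarith
  rw [lintegral_zero] at hFt
  filter_upwards [hFt.eventually_lt_const hε2] with n hn
  calc ∫⁻ ω, ENNReal.ofReal |ζ n ω * η ω| ∂P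
      ≤ ∫⁻ ω, (F n ω + ENNReal.ofReal (l / k) * ENNReal.ofReal (conj Φ (ζ n ω / l))) ∂P := by
        refine lintegral_mono fun ω => ?_
        simp only [hF]
        rw [← ENNReal.ofReal_mul hlk.le]
        refine le_trans (ENNReal.ofReal_le_ofReal ?_) ENNReal.ofReal_add_le
        linarith
    _ = ∫⁻ ω, F n ω ∂P +
          ENNReal.ofReal (l / k) * ∫⁻ ω, ENNReal.ofReal (conj Φ (ζ n ω / l)) ∂P := by
        rw [lintegral_add_left (hFm n), lintegral_const_mul' _ _ ENNReal.ofReal_ne_top]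
    _ ≤ ε / 2 + ε / 2 * 1 := by
        gcongr
        exact (hζ n).2
    _ = ε := by rw [mul_one, ENNReal.add_halves]

theorem memOrlicz_of_forall {η : Ω → ℝ} (hη : Measurable η)
    (hηk : ∀ k : ℕ, ∫⁻ ω, ENNReal.ofReal (Φ (k * η ω)) ∂P < ⊤) : MemOrlicz P Φ η :=
  ⟨hη, 1, one_pos, by simpa using hηk 1⟩

theorem tendsto_pairing (hΦ : IsYoung Φ) {η : Ω → ℝ} (hη : Measurable η)
    (hηk : ∀ k : ℕ, ∫⁻ ω, ENNReal.ofReal (Φ (k * η ω)) ∂P < ⊤) {l : ℝ} (hl : 0 < l)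
    {ξ : ℕ → Ω → ℝ} {ξ₀ : Ω → ℝ} (hξ : ∀ n, ξ n ∈ modBall P (conj Φ) l) (hξ₀ : Measurable ξ₀)
    (h : ∀ᵐ ω ∂P, Tendsto (fun n => ξ n ω) atTop (𝓝 (ξ₀ ω))) :
    Tendsto (fun n => pairing P (ξ n) η) atTop (𝓝 (pairing P ξ₀ η)) := by
  have hG := hΦ.isEvenConvex_conj
  have h0 := modBall_of_tendsto hG hξ hξ₀ h
  have hηo := memOrlicz_of_forall hη hηk
  have hζ : ∀ n, ξ n + (-1 : ℝ) • ξ₀ ∈ modBall P (conj Φ) (l + l) := fun n =>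
    modBall_add hG hl hl (hξ n) (modBall_smul hG hl hl (by simp) h0)
  have key := tendsto_lintegral_mul hΦ hη hηk (add_pos hl hl) hζ (by
    filter_upwards [h] with ω hω
    simpa [← sub_eq_add_neg] using hω.sub_const (ξ₀ ω))
  refine tendsto_integral_of_L1 _
    (integrable_mul hΦ (memOrlicz_of_modBall hl h0) hηo).aestronglyMeasurable
    (Eventually.of_forall fun n => integrable_mul hΦ (memOrlicz_of_modBall hl (hξ n)) hηo) ?_
  refine key.congr fun n => lintegral_congr fun ω => ?_
  rw [← ofReal_norm, Real.norm_eq_abs]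
  congr 2
  simp only [Pi.add_apply, Pi.smul_apply, smul_eq_mul]
  ring

theorem Delta2.lintegral_lt_top (hΔ : Delta2 Φ) (hΦ : IsYoung Φ) [IsFiniteMeasure P]
    {η : Ω → ℝ} (hη : MemOrlicz P Φ η) (k : ℕ) :
    ∫⁻ ω, ENNReal.ofReal (Φ (k * η ω)) ∂P < ⊤ := by
  obtain ⟨C, x₀, hC⟩ := hΔ
  obtain ⟨hm, l, hl, hfin⟩ := hη
  have hE := hΦ.isEvenConvex
  have hdouble : ∀ x, Φ (2 * x) ≤ |C| * Φ x + Φ (2 * x₀) := fun x => by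
    have h0 := mul_nonneg (abs_nonneg C) (hE.nonneg x)
    rcases le_total x₀ |x| with hx | hx
    · have := hC |x| hx
      rw [hE.map_abs, ← hE.map_abs, abs_mul, abs_abs, ← abs_mul, hE.map_abs] at this
      have := mul_le_mul_of_nonneg_right (le_abs_self C) (hE.nonneg x)
      linarith [hE.nonneg (2 * x₀)]
    · have : Φ (2 * x) ≤ Φ (2 * x₀) := hE.mono (by
        rw [abs_mul, abs_mul]
        exact mul_le_mul_of_nonneg_left (hx.trans (le_abs_self _)) (abs_nonneg _))
      linarith
  have hpow : ∀ n : ℕ, ∫⁻ ω, ENNReal.ofReal (Φ (2 ^ n * (l * η ω))) ∂P < ⊤ := fun n => by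
    induction n with
    | zero => simpa using hfin
    | succ n ih =>
      calc ∫⁻ ω, ENNReal.ofReal (Φ (2 ^ (n + 1) * (l * η ω))) ∂P
          ≤ ∫⁻ ω, (ENNReal.ofReal |C| * ENNReal.ofReal (Φ (2 ^ n * (l * η ω))) +
              ENNReal.ofReal (Φ (2 * x₀))) ∂P := by
            refine lintegral_mono fun ω => ?_
            simp only
            rw [← ENNReal.ofReal_mul (abs_nonneg C), ← ENNReal.ofReal_add
              (mul_nonneg (abs_nonneg C) (hE.nonneg _)) (hE.nonneg _), pow_succ']
            refine ENNReal.ofReal_le_ofReal ?_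
            rw [mul_assoc]
            exact hdouble _
        _ = ENNReal.ofReal |C| * ∫⁻ ω, ENNReal.ofReal (Φ (2 ^ n * (l * η ω))) ∂P +
              ENNReal.ofReal (Φ (2 * x₀)) * P univ := by
            rw [lintegral_add_right _ measurable_const,
              lintegral_const_mul' _ _ ENNReal.ofReal_ne_top, lintegral_const]
        _ < ⊤ := ENNReal.add_lt_top.2 ⟨ENNReal.mul_lt_top ENNReal.ofReal_lt_top ih,
            ENNReal.mul_lt_top ENNReal.ofReal_lt_top (measure_lt_top P _)⟩
  obtain ⟨n, hn⟩ := pow_unbounded_of_one_lt (k / l) one_lt_two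
  refine lt_of_le_of_lt (lintegral_mono fun ω => ENNReal.ofReal_le_ofReal (hE.mono ?_)) (hpow n)
  rw [div_lt_iff₀ hl] at hn
  rw [← mul_assoc, abs_mul, abs_mul, abs_of_nonneg (Nat.cast_nonneg k),
    abs_of_pos (by positivity : (0 : ℝ) < 2 ^ n * l)]
  gcongr

end Pairing

/-! ### Decreasing sequences of bounded convex sets -/

section Nested

/-- A quantitative form of the strict convexity of `x ↦ √(1 + x²)`. -/
theorem sqrt_abs_sub_le (a b : ℝ) {δ : ℝ} (hδ : 0 < δ) :
    √|a - b| ≤ (√(1 + a ^ 2) + √(1 + b ^ 2) - 2 * √(1 + ((a + b) / 2) ^ 2)) / δ ^ 3 +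
      δ * (√(1 + a ^ 2) + √(1 + b ^ 2)) := by
  have hu2 : √(1 + a ^ 2) ^ 2 = 1 + a ^ 2 := Real.sq_sqrt (by positivity)
  have hv2 : √(1 + b ^ 2) ^ 2 = 1 + b ^ 2 := Real.sq_sqrt (by positivity)
  have hw2 : √(1 + ((a + b) / 2) ^ 2) ^ 2 = 1 + ((a + b) / 2) ^ 2 :=
    Real.sq_sqrt (by positivity)
  set u := √(1 + a ^ 2)
  set v := √(1 + b ^ 2)
  set w := √(1 + ((a + b) / 2) ^ 2)
  have hu : 0 ≤ u := Real.sqrt_nonneg _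
  have hv : 0 ≤ v := Real.sqrt_nonneg _
  have hw : 0 ≤ w := Real.sqrt_nonneg _
  have huv : |1 + a * b| ≤ u * v := by
    refine abs_le_of_sq_le_sq ?_ (by positivity)
    rw [mul_pow, hu2, hv2]
    nlinarith [sq_nonneg (a - b)]
  have huv' := abs_le.1 huv
  have hfac : (u + v - 2 * w) * (u + v + 2 * w) = 2 * (u * v - (1 + a * b)) := by
    linear_combination hu2 + hv2 - 4 * hw2
  have hprod : (u * v - (1 + a * b)) * (u * v + (1 + a * b)) = (a - b) ^ 2 := by
    linear_combination v ^ 2 * hu2 + (1 + a ^ 2) * hv2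
  have hwS : 2 * w ≤ u + v := by
    refine abs_le_of_sq_le_sq' ?_ (by positivity) |>.2
    nlinarith
  have hg : 0 ≤ u + v - 2 * w := by linarith
  have h1 : u * v - (1 + a * b) ≤ (u + v - 2 * w) * (u + v) := by nlinarith
  have h2 : u * v + (1 + a * b) ≤ (u + v) ^ 2 := by nlinarith [sq_nonneg (u - v)]
  have hmain : (a - b) ^ 2 ≤ (u + v - 2 * w) * (u + v) ^ 3 := by
    rw [← hprod]
    calc _ ≤ (u + v - 2 * w) * (u + v) * (u + v) ^ 2 :=
          mul_le_mul h1 h2 (by linarith) (by positivity)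
      _ = _ := by ring
  set x := (u + v - 2 * w) / δ ^ 3 with hx
  set y := δ * (u + v) with hy
  have hx0 : 0 ≤ x := by positivity
  have hy0 : 0 ≤ y := by positivity
  have hxy : (u + v - 2 * w) * (u + v) ^ 3 = x * y ^ 3 := by
    rw [hx, hy]; field_simp
  rw [Real.sqrt_le_left (by positivity)]
  refine abs_le_of_sq_le_sq ?_ (by positivity)
  rw [hxy] at hmain
  refine hmain.trans ?_
  have : x * y ^ 3 ≤ (x + y) * (x + y) ^ 3 := by gcongr <;> linarith
  linarith [show ((x + y) ^ 2) ^ 2 = (x + y) * (x + y) ^ 3 by ring]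

theorem ae_summable_of_integral_le {Ω : Type*} [MeasurableSpace Ω] {P : Measure Ω}
    {T : ℕ → Ω → ℝ} (hT : ∀ j, Integrable (T j) P)
    (hT0 : ∀ j ω, 0 ≤ T j ω) {c : ℕ → ℝ} (hc : Summable c) (h : ∀ j, ∫ ω, T j ω ∂P ≤ c j) :
    ∀ᵐ ω ∂P, Summable fun j => T j ω := by
  have hc0 : ∀ j, 0 ≤ c j := fun j => (integral_nonneg (hT0 j)).trans (h j)
  have hfin : ∫⁻ ω, ∑' j, ENNReal.ofReal (T j ω) ∂P ≠ ⊤ := by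
    rw [lintegral_tsum fun j => (hT j).1.aemeasurable.ennreal_ofReal]
    refine ne_top_of_le_ne_top hc.tsum_ofReal_ne_top (ENNReal.tsum_le_tsum fun j => ?_)
    rw [← ofReal_integral_eq_lintegral_ofReal (hT j) (ae_of_all _ (hT0 j))]
    exact ENNReal.ofReal_le_ofReal (h j)
  have hm : AEMeasurable (fun ω => ∑' j, ENNReal.ofReal (T j ω)) P :=
    AEMeasurable.tsum fun j => (hT j).1.aemeasurable.ennreal_ofReal
  filter_upwards [ae_lt_top' hm hfin] with ω hω
  have := ENNReal.summable_toReal hω.ne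
  simpa [ENNReal.toReal_ofReal, hT0] using this

variable {Ω : Type*} [MeasurableSpace Ω] {P : Measure Ω} [IsProbabilityMeasure P] {Φ : ℝ → ℝ}

theorem memOrlicz_one : MemOrlicz P Φ (fun _ : Ω => (1 : ℝ)) :=
  memOrlicz_of_forall measurable_const fun k => by simp

theorem integrable_of_memOrlicz_conj (hΦ : IsYoung Φ) {ξ : Ω → ℝ}
    (hξ : MemOrlicz P (conj Φ) ξ) : Integrable ξ P := by
  simpa using integrable_mul hΦ hξ memOrlicz_one

theorem integral_abs_le (hΦ : IsYoung Φ) {l : ℝ} (hl : 0 < l) {ξ : Ω → ℝ}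
    (hξ : ξ ∈ modBall P (conj Φ) l) : ∫ ω, |ξ ω| ∂P ≤ l * Φ 1 + l := by
  have hΦ1 := hΦ.isEvenConvex.nonneg 1
  rw [integral_eq_lintegral_of_nonneg_ae (ae_of_all _ fun ω => abs_nonneg _)
    hξ.1.abs.aestronglyMeasurable]
  refine ENNReal.toReal_le_of_le_ofReal (by positivity) ?_
  calc ∫⁻ ω, ENNReal.ofReal |ξ ω| ∂P
      ≤ ∫⁻ ω, (ENNReal.ofReal (l * Φ 1) +
          ENNReal.ofReal l * ENNReal.ofReal (conj Φ (ξ ω / l))) ∂P := by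
        refine lintegral_mono fun ω => ?_
        simp only
        rw [← ENNReal.ofReal_mul hl.le, ← ENNReal.ofReal_add (by positivity)
          (mul_nonneg hl.le (hΦ.isEvenConvex_conj.nonneg _))]
        refine ENNReal.ofReal_le_ofReal ?_
        have := mul_le_mul_of_nonneg_left (hΦ.abs_mul_le 1 (ξ ω / l)) hl.le
        rw [one_mul, abs_div, abs_of_pos hl, mul_div_cancel₀ _ hl.ne'] at this
        linarith
    _ = ENNReal.ofReal (l * Φ 1) +
          ENNReal.ofReal l * ∫⁻ ω, ENNReal.ofReal (conj Φ (ξ ω / l)) ∂P := by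
        rw [lintegral_add_left measurable_const, lintegral_const_mul' _ _ ENNReal.ofReal_ne_top]
        simp
    _ ≤ ENNReal.ofReal (l * Φ 1) + ENNReal.ofReal l * 1 := by gcongr; exact hξ.2
    _ = ENNReal.ofReal (l * Φ 1 + l) := by
        rw [mul_one, ENNReal.ofReal_add (by positivity) hl.le]

theorem integrable_sqrt_one_add_sq {ξ : Ω → ℝ} (hξ : Integrable ξ P) :
    Integrable (fun ω => √(1 + ξ ω ^ 2)) P := by
  refine ((integrable_const (1 : ℝ)).add hξ.abs).mono'
    ((Real.continuous_sqrt.comp (by fun_prop : Continuous fun x : ℝ => 1 + x ^ 2)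
      ).comp_aestronglyMeasurable hξ.1) (ae_of_all _ fun ω => ?_)
  rw [Real.norm_eq_abs, abs_of_nonneg (Real.sqrt_nonneg _), Real.sqrt_le_left (by
    have := abs_nonneg (ξ ω); simp only [Pi.add_apply]; positivity)]
  simp only [Pi.add_apply]
  nlinarith [abs_nonneg (ξ ω), sq_abs (ξ ω)]

/-- A decreasing sequence of nonempty convex sets, bounded in `L_{Φ*}` and closed under almost sure
convergence, has a common point. -/
theorem exists_forall_mem_of_antitone (hΦ : IsYoung Φ) {l : ℝ} (hl : 0 < l)
    {D : ℕ → Set (Ω → ℝ)} (hanti : Antitone D) (hne : ∀ k, (D k).Nonempty)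
    (hconv : ∀ k, Convex ℝ (D k)) (hsub : ∀ k, D k ⊆ modBall P (conj Φ) l)
    (hclosed : ∀ k (ξ : ℕ → Ω → ℝ) (ξ₀ : Ω → ℝ), (∀ n, ξ n ∈ D k) → Measurable ξ₀ →
      (∀ᵐ ω ∂P, Tendsto (fun n => ξ n ω) atTop (𝓝 (ξ₀ ω))) → ξ₀ ∈ D k) :
    ∃ ξ, ∀ k, ξ ∈ D k := by
  have hInt : ∀ k, ∀ ξ ∈ D k, Integrable ξ P := fun k ξ hξ =>
    integrable_of_memOrlicz_conj hΦ (memOrlicz_of_modBall hl (hsub k hξ))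
  set J : (Ω → ℝ) → ℝ := fun ξ => ∫ ω, √(1 + ξ ω ^ 2) ∂P with hJ
  have hJ0 : ∀ ξ, 0 ≤ J ξ := fun ξ => integral_nonneg fun ω => Real.sqrt_nonneg _
  set M : ℝ := 1 + (l * Φ 1 + l) with hM
  have hJM : ∀ k, ∀ ξ ∈ D k, J ξ ≤ M := fun k ξ hξ => by
    calc J ξ ≤ ∫ ω, (1 + |ξ ω|) ∂P := by
          refine integral_mono (integrable_sqrt_one_add_sq (hInt k ξ hξ))
            ((integrable_const _).add (hInt k ξ hξ).abs) fun ω => ?_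
          simp only
          rw [Real.sqrt_le_left (by positivity)]
          nlinarith [abs_nonneg (ξ ω), sq_abs (ξ ω)]
      _ ≤ M := by
          rw [integral_add (integrable_const _) (hInt k ξ hξ).abs]
          simpa [hM] using integral_abs_le hΦ hl (hsub k hξ)
  have hbdd : ∀ k, BddBelow (J '' D k) := fun k => ⟨0, by rintro _ ⟨ξ, -, rfl⟩; exact hJ0 ξ⟩
  set v : ℕ → ℝ := fun k => sInf (J '' D k) with hv
  have hvle : ∀ k, ∀ ξ ∈ D k, v k ≤ J ξ := fun k ξ hξ => csInf_le (hbdd k) ⟨ξ, hξ, rfl⟩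
  have hvmono : Monotone v := fun k m hkm =>
    csInf_le_csInf (hbdd k) ((hne m).image J) (image_mono (hanti hkm))
  have hvbdd : BddAbove (range v) := by
    refine ⟨M, ?_⟩
    rintro _ ⟨k, rfl⟩
    obtain ⟨ξ, hξ⟩ := hne k
    exact (hvle k ξ hξ).trans (hJM k ξ hξ)
  set V := ⨆ k, v k
  have hvt : Tendsto v atTop (𝓝 V) := tendsto_atTop_ciSup hvmono hvbdd
  obtain ⟨φ, hφ, hφV⟩ := extraction_forall_of_eventually (P := fun j k => V - 1 / 16 ^ j < v k)
    fun j => hvt.eventually_const_lt (sub_lt_self _ (by positivity))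
  have hex : ∀ j, ∃ ξ ∈ D (φ j), J ξ < V + 1 / 16 ^ j := fun j => by
    have : sInf (J '' D (φ j)) < V + 1 / 16 ^ j :=
      lt_of_le_of_lt (le_ciSup hvbdd (φ j)) (lt_add_of_pos_right _ (by positivity))
    obtain ⟨_, ⟨ξ, hξ, rfl⟩, h⟩ := exists_lt_of_csInf_lt ((hne _).image J) this
    exact ⟨ξ, hξ, h⟩
  choose ξ hξD hξJ using hex
  have hmem : ∀ {m j}, m ≤ j → ξ j ∈ D m := fun {m j} hmj =>
    hanti (hmj.trans (hφ.id_le j)) (hξD j)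
  have hξint : ∀ j, Integrable (ξ j) P := fun j => hInt _ _ (hξD j)
  have hsqrt : ∀ j, Integrable (fun ω => √(1 + ξ j ω ^ 2)) P := fun j =>
    integrable_sqrt_one_add_sq (hξint j)
  have hmid : ∀ j, Integrable (fun ω => √(1 + ((ξ j ω + ξ (j + 1) ω) / 2) ^ 2)) P := fun j =>
    integrable_sqrt_one_add_sq (((hξint j).add (hξint (j + 1))).div_const 2)
  have hmidV : ∀ j, V - 1 / 16 ^ j ≤ ∫ ω, √(1 + ((ξ j ω + ξ (j + 1) ω) / 2) ^ 2) ∂P := fun j => by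
    have h1 : ξ (j + 1) ∈ D (φ j) := hanti (hφ (Nat.lt_succ_self j)).le (hξD (j + 1))
    have h2 := hconv (φ j) (hξD j) h1 (a := 1 / 2) (b := 1 / 2) (by norm_num) (by norm_num)
      (by norm_num)
    have h3 := hvle _ _ h2
    refine (hφV j).le.trans (h3.trans_eq (integral_congr_ae (ae_of_all _ fun ω => ?_)))
    simp only [Pi.add_apply, Pi.smul_apply, smul_eq_mul]
    congr 3
    ring
  have hadd : ∀ j, Integrable (fun ω => √(1 + ξ j ω ^ 2) + √(1 + ξ (j + 1) ω ^ 2)) P := fun j =>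
    (hsqrt j).add (hsqrt (j + 1))
  have hdiff : ∀ j, Integrable (fun ω => √(1 + ξ j ω ^ 2) + √(1 + ξ (j + 1) ω ^ 2) -
      2 * √(1 + ((ξ j ω + ξ (j + 1) ω) / 2) ^ 2)) P := fun j =>
    (hadd j).sub ((hmid j).const_mul 2)
  have hbound : ∀ j, Integrable (fun ω => (√(1 + ξ j ω ^ 2) + √(1 + ξ (j + 1) ω ^ 2) -
      2 * √(1 + ((ξ j ω + ξ (j + 1) ω) / 2) ^ 2)) / (1 / 2 ^ j) ^ 3 +
      1 / 2 ^ j * (√(1 + ξ j ω ^ 2) + √(1 + ξ (j + 1) ω ^ 2))) P := fun j =>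
    ((hdiff j).div_const _).add ((hadd j).const_mul _)
  have hle : ∀ j ω, √|ξ j ω - ξ (j + 1) ω| ≤ _ := fun j ω =>
    sqrt_abs_sub_le (ξ j ω) (ξ (j + 1) ω) (δ := 1 / 2 ^ j) (by positivity)
  have hTint : ∀ j, Integrable (fun ω => √|ξ j ω - ξ (j + 1) ω|) P := fun j =>
    (hbound j).mono' (Real.continuous_sqrt.comp_aestronglyMeasurable
      ((hξint j).sub (hξint (j + 1))).abs.1) (ae_of_all _ fun ω => by
        rw [Real.norm_eq_abs, abs_of_nonneg (Real.sqrt_nonneg _)]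
        exact hle j ω)
  have hTle : ∀ j, ∫ ω, √|ξ j ω - ξ (j + 1) ω| ∂P ≤ (4 + 2 * M) * (1 / 2) ^ j := fun j => by
    refine (integral_mono (hTint j) (hbound j) (hle j)).trans ?_
    rw [integral_add ((hdiff j).div_const _) ((hadd j).const_mul _), integral_div,
      integral_sub (hadd j) ((hmid j).const_mul 2),
      integral_const_mul, integral_const_mul, integral_add (hsqrt j) (hsqrt (j + 1))]
    have e1 : ∫ ω, √(1 + ξ j ω ^ 2) ∂P < V + 1 / 16 ^ j := hξJ j
    have e2 : ∫ ω, √(1 + ξ (j + 1) ω ^ 2) ∂P < V + 1 / 16 ^ (j + 1) := hξJ (j + 1)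
    have e3 : (1 : ℝ) / 16 ^ (j + 1) ≤ 1 / 16 ^ j := by
      gcongr
      · norm_num
      · omega
    have e4 : ∫ ω, √(1 + ξ j ω ^ 2) ∂P ≤ M := hJM _ _ (hξD j)
    have e5 : ∫ ω, √(1 + ξ (j + 1) ω ^ 2) ∂P ≤ M := hJM _ _ (hξD (j + 1))
    have e6 := hmidV j
    have hpow : (16 : ℝ) ^ j = (2 ^ j) ^ 4 := by rw [← pow_mul, mul_comm, pow_mul]; norm_num
    have hp : (0 : ℝ) < 2 ^ j := by positivity
    have e7 : (4 * (1 / (16 : ℝ) ^ j)) / (1 / 2 ^ j) ^ 3 = 4 * (1 / 2) ^ j := by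
      rw [hpow, div_pow, div_pow, one_pow, one_pow]
      field_simp
    calc _ ≤ (4 * (1 / 16 ^ j)) / (1 / 2 ^ j) ^ 3 + 1 / 2 ^ j * (M + M) := by
          gcongr
          linarith
      _ = _ := by rw [e7, div_pow, one_pow]; ring
  have hsum := ae_summable_of_integral_le hTint (fun j ω => Real.sqrt_nonneg _)
    ((summable_geometric_two).mul_left (4 + 2 * M)) hTle
  obtain ⟨ξ₀, hξ₀, hlim⟩ := measurable_limit_of_tendsto_metrizable_ae
    (μ := P) (f := ξ) (L := atTop) (fun j => (hξint j).1.aemeasurable) (by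
      filter_upwards [hsum] with ω hω
      refine cauchySeq_tendsto_of_complete (cauchySeq_of_summable_dist ?_)
      refine Summable.of_norm_bounded_eventually_nat hω ?_
      filter_upwards [hω.tendsto_atTop_zero.eventually_le_const one_pos] with j hj
      rw [Real.dist_eq, Real.norm_eq_abs, abs_abs]
      have h1 := Real.sqrt_nonneg |ξ j ω - ξ (j + 1) ω|
      have h2 := Real.mul_self_sqrt (abs_nonneg (ξ j ω - ξ (j + 1) ω))
      change |ξ j ω - ξ (j + 1) ω| ≤ _
      nlinarith)
  refine ⟨ξ₀, fun k => hclosed k (fun j => ξ (j + k)) ξ₀ (fun j => hmem (by omega)) hξ₀ ?_⟩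
  filter_upwards [hlim] with ω hω
  exact hω.comp (tendsto_add_atTop_nat k)

end Nested

/-! ### Separation -/

/-- An absolutely convex absorbing set can be separated from a convex set disjoint from it. -/
theorem exists_linearMap_of_disjoint {E : Type*} [AddCommGroup E] [Module ℝ E] {V C : Set E}
    (hVb : Balanced ℝ V) (hVc : Convex ℝ V) (hVa : ∀ x, ∀ᶠ c : ℝ in 𝓝[≠] 0, c • x ∈ V)
    (hC : Convex ℝ C) (hd : Disjoint V C) :
    ∃ (f : E →ₗ[ℝ] ℝ) (u : ℝ), 0 < u ∧ (∀ x ∈ V, |f x| ≤ u) ∧ ∀ x ∈ C, u ≤ f x := by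
  rw [← absorbent_iff_eventually_nhdsNE_zero] at hVa
  let p : SeminormFamily ℝ E Unit := fun _ => gaugeSeminorm hVb hVc hVa
  let _ : TopologicalSpace E := p.moduleFilterBasis.topology
  have hp : WithSeminorms p := ⟨rfl⟩
  have := hp.topologicalAddGroup
  have := hp.continuousSMul
  have hopen : IsOpen {x | p () x < 1} :=
    isOpen_lt (hp.continuous_seminorm ()) continuous_const
  have hsub : {x | p () x < 1} ⊆ V := setOfPred_gauge_lt_one_subset_self hVc hVa.zero_mem hVa
  have hcv : Convex ℝ {x | p () x < 1} := by
    simpa [Seminorm.ball_zero_eq] using (p ()).convex_ball 0 1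
  obtain ⟨f, u, hfu, hfC⟩ := geometric_hahn_banach_open hcv hopen hC (hd.mono_left hsub)
  have hu : 0 < u := by simpa using hfu 0 (by simp)
  have hle : ∀ x ∈ V, f x ≤ u := fun x hx => by
    have key : ∀ t : ℝ, 0 ≤ t → t < 1 → t * f x ≤ u := fun t ht ht1 => by
      have h1 : p () (t • x) < 1 := by
        rw [map_smul_eq_mul, Real.norm_eq_abs, abs_of_nonneg ht]
        have : p () x ≤ 1 := gauge_le_one_of_mem hx
        have h0 := apply_nonneg (p ()) x
        nlinarith
      simpa using (hfu _ h1).le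
    by_contra! hlt
    have hpos := hu.trans hlt
    have := key ((u / f x + 1) / 2) (by positivity) (by
      have := (div_lt_one hpos).2 hlt
      linarith)
    have h2 : (u / f x + 1) / 2 * f x = (u + f x) / 2 := by field_simp
    linarith
  refine ⟨f.toLinearMap, u, hu, fun x hx => abs_le.2 ⟨?_, hle x hx⟩, hfC⟩
  have := hle (-x) (hVb.neg_mem_iff.2 hx)
  simp only [map_neg] at this
  simp only [ContinuousLinearMap.coe_coe]
  linarith

section Truncation

variable {Ω : Type*} [MeasurableSpace Ω] {P : Measure Ω} {Φ : ℝ → ℝ}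

/-- A set of functions is boundedly closed if it is closed under almost sure convergence of
sequences that are bounded in `L_G`. -/
def BoundedlyClosed (P : Measure Ω) (G : ℝ → ℝ) (D : Set (Ω → ℝ)) : Prop :=
  ∀ (l : ℝ) (ξ : ℕ → Ω → ℝ) (ξ₀ : Ω → ℝ), 0 < l → (∀ n, ξ n ∈ D) → (∀ n, ξ n ∈ modBall P G l) →
    Measurable ξ₀ → (∀ᵐ ω ∂P, Tendsto (fun n => ξ n ω) atTop (𝓝 (ξ₀ ω))) → ξ₀ ∈ D

theorem BoundedlyClosed.inter_modBall {G H : ℝ → ℝ} {D : Set (Ω → ℝ)} (hD : BoundedlyClosed P G D)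
    (hH : IsEvenConvex H) (m : ℝ) : BoundedlyClosed P G (D ∩ modBall P H m) :=
  fun l ξ ξ₀ hl hξ hξl hξ₀ h => ⟨hD l ξ ξ₀ hl (fun n => (hξ n).1) hξl hξ₀ h,
    modBall_of_tendsto hH (fun n => (hξ n).2) hξ₀ h⟩

theorem modBall_conj_subset_truncConj (hΦ : IsYoung Φ) (k : ℕ) (l : ℝ) :
    modBall P (conj Φ) l ⊆ modBall P (truncConj Φ k) l := fun _ hξ =>
  ⟨hξ.1, (lintegral_mono fun _ => ENNReal.ofReal_le_ofReal (hΦ.truncConj_le_conj _ _)).trans hξ.2⟩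

theorem modBall_truncConj_antitone (hΦ : IsYoung Φ) (l : ℝ) :
    Antitone fun k => modBall P (truncConj Φ k) l := fun _ _ hkm _ hξ =>
  ⟨hξ.1, (lintegral_mono fun _ => ENNReal.ofReal_le_ofReal (hΦ.truncConj_mono _ hkm)).trans hξ.2⟩

theorem modBall_conj_of_forall_truncConj (hΦ : IsYoung Φ) {l : ℝ} {ξ : Ω → ℝ}
    (h : ∀ k, ξ ∈ modBall P (truncConj Φ k) l) : ξ ∈ modBall P (conj Φ) l := by
  refine ⟨(h 0).1, le_of_tendsto' (lintegral_tendsto_of_tendsto_of_monotone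
    (fun k => ((hΦ.isEvenConvex_truncConj k).measurable.comp
      ((h 0).1.div_const l)).ennreal_ofReal.aemeasurable) (ae_of_all _ fun ω => ?_)
    (ae_of_all _ fun ω => ?_)) fun k => (h k).2⟩
  · exact fun _ _ hkm => ENNReal.ofReal_le_ofReal (hΦ.truncConj_mono _ hkm)
  · exact ENNReal.tendsto_ofReal (hΦ.tendsto_truncConj _)

variable [IsProbabilityMeasure P]

theorem exists_disjoint_modBall_truncConj (hΦ : IsYoung Φ) {D : Set (Ω → ℝ)} (hconv : Convex ℝ D)
    (hD : BoundedlyClosed P (conj Φ) D) {l m : ℝ} (hl : 0 < l) (hm : 0 < m)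
    (hdisj : Disjoint D (modBall P (conj Φ) l)) :
    ∃ k, Disjoint (D ∩ modBall P (truncConj Φ k) l) (modBall P (conj Φ) m) := by
  by_contra! hne
  obtain ⟨ξ, hξ⟩ := exists_forall_mem_of_antitone hΦ hm
    (D := fun k => D ∩ modBall P (truncConj Φ k) l ∩ modBall P (conj Φ) m)
    (fun k j hkj => inter_subset_inter_left _
      (inter_subset_inter_right _ (modBall_truncConj_antitone hΦ l hkj)))
    (fun k => not_disjoint_iff_nonempty_inter.1 (hne k))
    (fun k => (hconv.inter (convex_modBall (hΦ.isEvenConvex_truncConj k) hl)).inter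
      (convex_modBall hΦ.isEvenConvex_conj hm))
    (fun k => inter_subset_right)
    (fun k ξ ξ₀ hξ hξ₀ h => ((hD.inter_modBall (hΦ.isEvenConvex_truncConj k) l).inter_modBall
      hΦ.isEvenConvex_conj m) m ξ ξ₀ hm hξ (fun n => (hξ n).2) hξ₀ h)
  exact Set.disjoint_left.1 hdisj (hξ 0).1.1
    (modBall_conj_of_forall_truncConj hΦ fun k => (hξ k).1.2)

/-- The absolutely convex set cut out by the truncated modulars along the radii `r, 2r, 3r, …`. -/
def truncPolar (P : Measure Ω) (Φ : ℝ → ℝ) (r : ℝ) (κ : ℕ → ℕ) : Set (Ω → ℝ) :=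
  ⋂ i : ℕ, modBall P (truncConj Φ (κ i)) (r * (i + 1))

theorem exists_disjoint_truncPolar (hΦ : IsYoung Φ) {C : Set (Ω → ℝ)} (hconv : Convex ℝ C)
    (hC : BoundedlyClosed P (conj Φ) C) (hCE : C ⊆ Orlicz P (conj Φ)) {r : ℝ} (hr : 0 < r)
    (hdisj : Disjoint C (modBall P (conj Φ) r)) : ∃ κ, Disjoint (truncPolar P Φ r κ) C := by
  have hrn : ∀ n : ℕ, 0 < r * (n + 1) := fun n => by positivity
  let Q : ℕ → Set (Ω → ℝ) → Prop := fun n D =>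
    Convex ℝ D ∧ BoundedlyClosed P (conj Φ) D ∧ Disjoint D (modBall P (conj Φ) (r * (n + 1)))
  have step : ∀ n D, Q n D → ∃ k, Q (n + 1) (D ∩ modBall P (truncConj Φ k) (r * (n + 1))) := by
    rintro n D ⟨h1, h2, h3⟩
    obtain ⟨k, hk⟩ := exists_disjoint_modBall_truncConj hΦ h1 h2 (hrn n) (hrn (n + 1)) h3
    exact ⟨k, h1.inter (convex_modBall (hΦ.isEvenConvex_truncConj k) (hrn n)),
      h2.inter_modBall (hΦ.isEvenConvex_truncConj k) _, hk⟩
  choose k hk using step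
  let D : (n : ℕ) → {D // Q n D} := fun n =>
    Nat.rec ⟨C, hconv, hC, by simpa using hdisj⟩ (fun n D => ⟨_, hk n D.1 D.2⟩) n
  have hDsub : ∀ n ξ, ξ ∈ C →
      ξ ∈ truncPolar P Φ r (fun i => k i (D i).1 (D i).2) → ξ ∈ (D n).1 := by
    intro n ξ hξC hξ
    induction n with
    | zero => exact hξC
    | succ n ih => exact ⟨ih, mem_iInter.1 hξ n⟩
  refine ⟨fun i => k i (D i).1 (D i).2, Set.disjoint_left.2 fun ξ hξ hξC => ?_⟩
  obtain ⟨l, hl, hξl⟩ := exists_modBall hΦ.isEvenConvex_conj (hCE hξC)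
  obtain ⟨n, hn⟩ := exists_nat_ge (l / r)
  refine Set.disjoint_left.1 (D n).2.2.2 (hDsub n ξ hξC hξ)
    (modBall_mono hΦ.isEvenConvex_conj hl ?_ hξl)
  rw [div_le_iff₀ hr] at hn
  nlinarith

end Truncation

/-! ### Representation of boundedly continuous functionals -/

section Representation

theorem abs_indicator_one_le {Ω : Type*} (A : Set Ω) (ω : Ω) : |A.indicator (1 : Ω → ℝ) ω| ≤ 1 := by
  by_cases h : ω ∈ A <;> simp [h]

variable {Ω : Type*} [MeasurableSpace Ω] {P : Measure Ω} {Φ G : ℝ → ℝ}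

/-- A linear functional is boundedly continuous if it is continuous along almost surely convergent
sequences that are bounded in `L_G`. -/
def BoundedlyContinuous (P : Measure Ω) (G : ℝ → ℝ) (f : (Ω → ℝ) →ₗ[ℝ] ℝ) : Prop :=
  ∀ (l : ℝ) (ξ : ℕ → Ω → ℝ), 0 < l → (∀ n, ξ n ∈ modBall P G l) →
    (∀ᵐ ω ∂P, Tendsto (fun n => ξ n ω) atTop (𝓝 0)) → Tendsto (fun n => f (ξ n)) atTop (𝓝 0)

theorem BoundedlyContinuous.tendsto {f : (Ω → ℝ) →ₗ[ℝ] ℝ} (hf : BoundedlyContinuous P G f)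
    (hG : IsEvenConvex G) {l : ℝ} (hl : 0 < l) {ξ : ℕ → Ω → ℝ} {ξ₀ : Ω → ℝ}
    (hξ : ∀ n, ξ n ∈ modBall P G l) (hξ₀ : Measurable ξ₀)
    (h : ∀ᵐ ω ∂P, Tendsto (fun n => ξ n ω) atTop (𝓝 (ξ₀ ω))) :
    Tendsto (fun n => f (ξ n)) atTop (𝓝 (f ξ₀)) := by
  have h0 := modBall_of_tendsto hG hξ hξ₀ h
  have key := hf (l + l) (fun n => ξ n + (-1 : ℝ) • ξ₀) (add_pos hl hl)
    (fun n => modBall_add hG hl hl (hξ n) (modBall_smul hG hl hl (by simp) h0)) (by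
      filter_upwards [h] with ω hω
      simpa [← sub_eq_add_neg] using hω.sub_const (ξ₀ ω))
  simpa using key.add_const (f ξ₀)

variable [IsProbabilityMeasure P]

theorem exists_forall_mem_modBall (hG : IsEvenConvex G) (B : ℝ) :
    ∃ l, 0 < l ∧ ∀ ξ : Ω → ℝ, Measurable ξ → (∀ ω, |ξ ω| ≤ B) → ξ ∈ modBall P G l := by
  obtain ⟨l, hl, h⟩ := exists_modBall (P := P) hG (ξ := fun _ => B)
    ⟨measurable_const, 1, one_pos, by simp⟩
  refine ⟨l, hl, fun ξ hξ hB => modBall_of_abs_le hG h hξ fun ω => ?_⟩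
  rw [abs_div, abs_div]
  have := (hB ω).trans (le_abs_self B)
  gcongr

theorem tendsto_indicator_one (hG : IsEvenConvex G) {f : (Ω → ℝ) →ₗ[ℝ] ℝ}
    (hf : BoundedlyContinuous P G f) {A : ℕ → Set Ω} {B : Set Ω} (hA : ∀ n, MeasurableSet (A n))
    (hB : MeasurableSet B) (h : ∀ ω, ∀ᶠ n in atTop, (ω ∈ A n ↔ ω ∈ B)) :
    Tendsto (fun n => f ((A n).indicator 1)) atTop (𝓝 (f (B.indicator 1))) := by
  obtain ⟨l, hl, hmem⟩ := exists_forall_mem_modBall (P := P) hG 1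
  refine hf.tendsto hG hl (fun n => hmem _ (measurable_one.indicator (hA n))
    (abs_indicator_one_le _)) (measurable_one.indicator hB) (ae_of_all _ fun ω => ?_)
  refine tendsto_const_nhds.congr' ?_
  filter_upwards [h ω] with n hn
  by_cases hω : ω ∈ B <;> simp [hω, hn]

open Classical in
/-- The signed measure `A ↦ f(1_A)`. -/
def functionalMeasure (hG : IsEvenConvex G) {f : (Ω → ℝ) →ₗ[ℝ] ℝ}
    (hf : BoundedlyContinuous P G f) : SignedMeasure Ω where
  measureOf' A := if MeasurableSet A then f (A.indicator 1) else 0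
  empty' := by
    rw [if_pos MeasurableSet.empty, indicator_empty]
    exact map_zero f
  not_measurable' A hA := by simp [hA]
  m_iUnion' A hA hd := by
    simp only [hA, MeasurableSet.iUnion hA, if_true]
    rw [HasSum, SummationFilter.unconditional_filter]
    refine tendsto_of_seq_tendsto fun s hs => ?_
    have hsum : ∀ n, ∑ i ∈ s n, f ((A i).indicator 1) = f ((⋃ i ∈ s n, A i).indicator 1) := by
      intro n
      rw [← map_sum, Finset.indicator_biUnion _ _ fun i _ j _ hij => hd hij]
      congr 1
      ext ω
      simp
    refine (tendsto_indicator_one hG hf (A := fun n => ⋃ i ∈ s n, A i)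
      (fun n => Finset.measurableSet_biUnion _ fun i _ => hA i) (MeasurableSet.iUnion hA)
      fun ω => ?_).congr fun n => (hsum n).symm
    by_cases hω : ∃ i, ω ∈ A i
    · obtain ⟨i, hi⟩ := hω
      filter_upwards [hs.eventually_ge_atTop {i}] with n hn
      exact iff_of_true (mem_iUnion₂.2 ⟨i, hn (Finset.mem_singleton_self i), hi⟩)
        (mem_iUnion.2 ⟨i, hi⟩)
    · refine Eventually.of_forall fun n => iff_of_false ?_ ?_ <;> simp_all

theorem exists_density (hG : IsEvenConvex G) {f : (Ω → ℝ) →ₗ[ℝ] ℝ}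
    (hf : BoundedlyContinuous P G f) :
    ∃ η : Ω → ℝ, Measurable η ∧ Integrable η P ∧
      ∀ A, MeasurableSet A → f (A.indicator 1) = ∫ ω in A, η ω ∂P := by
  set m := functionalMeasure hG hf with hm
  have hmA : ∀ A, MeasurableSet A → m A = f (A.indicator 1) := fun A hA => if_pos hA
  have hac : m ≪ᵥ P.toENNRealVectorMeasure := by
    refine VectorMeasure.AbsolutelyContinuous.mk fun A hA hPA => ?_
    rw [Measure.toENNRealVectorMeasure_apply_measurable hA] at hPA
    rw [hmA A hA]
    obtain ⟨l, hl, hmem⟩ := exists_forall_mem_modBall (P := P) hG 1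
    refine tendsto_nhds_unique tendsto_const_nhds (hf l (fun _ => A.indicator 1) hl
      (fun _ => hmem _ (measurable_one.indicator hA) (abs_indicator_one_le _)) ?_)
    filter_upwards [measure_eq_zero_iff_ae_notMem.1 hPA] with ω hω
    simp [hω]
  refine ⟨m.rnDeriv P, m.measurable_rnDeriv P, m.integrable_rnDeriv P, fun A hA => ?_⟩
  rw [← hmA A hA, ← withDensityᵥ_apply (m.integrable_rnDeriv P) hA, m.withDensityᵥ_rnDeriv_eq P hac]

theorem apply_eq_integral_of_bounded (hG : IsEvenConvex G) {f : (Ω → ℝ) →ₗ[ℝ] ℝ}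
    (hf : BoundedlyContinuous P G f) {η : Ω → ℝ} (hη : Integrable η P)
    (hfη : ∀ A, MeasurableSet A → f (A.indicator 1) = ∫ ω in A, η ω ∂P) {ξ : Ω → ℝ}
    (hξ : Measurable ξ) {B : ℝ} (hB : ∀ ω, |ξ ω| ≤ B) : f ξ = ∫ ω, ξ ω * η ω ∂P := by
  have hInt : ∀ s : SimpleFunc Ω ℝ, Integrable (fun ω => s ω * η ω) P := fun s => by
    obtain ⟨c, hc⟩ := s.exists_forall_norm_le
    exact hη.bdd_mul s.measurable.aestronglyMeasurable (ae_of_all _ hc)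
  have hsimple : ∀ s : SimpleFunc Ω ℝ, f s = ∫ ω, s ω * η ω ∂P := fun s => by
    induction s using SimpleFunc.induction with
    | const c hs =>
      rename_i A
      have h1 : (SimpleFunc.piecewise A hs (SimpleFunc.const Ω c) (SimpleFunc.const Ω 0) : Ω → ℝ) =
          c • A.indicator 1 := by
        ext ω
        by_cases hω : ω ∈ A <;> simp [hω]
      rw [h1, map_smul, hfη A hs, smul_eq_mul, ← integral_const_mul, ← integral_indicator hs]
      refine integral_congr_ae (ae_of_all _ fun ω => ?_)
      by_cases hω : ω ∈ A <;> simp [hω]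
    | add _ hs ht =>
      rename_i s t _
      rw [SimpleFunc.coe_add, map_add, hs, ht, ← integral_add (hInt s) (hInt t)]
      simp [add_mul]
  rcases isEmpty_or_nonempty Ω with hΩ | ⟨⟨ω₀⟩⟩
  · rw [show ξ = 0 from Subsingleton.elim _ _]
    simp
  have hB0 : 0 ≤ B := (abs_nonneg _).trans (hB ω₀)
  have hsm := hξ.stronglyMeasurable
  have hle := fun n ω => hsm.norm_approxBounded_le hB0 n ω
  have hlim : ∀ ω, Tendsto (fun n => hsm.approxBounded B n ω) atTop (𝓝 (ξ ω)) := fun ω =>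
    hsm.tendsto_approxBounded_of_norm_le (hB ω)
  obtain ⟨l, hl, hmem⟩ := exists_forall_mem_modBall (P := P) hG B
  refine tendsto_nhds_unique (hf.tendsto hG hl (ξ := fun n => hsm.approxBounded B n)
    (fun n => hmem _ (SimpleFunc.measurable _) (hle n)) hξ (ae_of_all _ hlim)) ?_
  simp only [hsimple]
  refine tendsto_integral_of_dominated_convergence (fun ω => B * |η ω|)
    (fun n => (hInt _).aestronglyMeasurable) (hη.abs.const_mul B)
    (fun n => ae_of_all _ fun ω => ?_) (ae_of_all _ fun ω => (hlim ω).mul_const _)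
  rw [norm_mul, Real.norm_eq_abs (η ω)]
  exact mul_le_mul_of_nonneg_right (hle n ω) (abs_nonneg _)

theorem IsEvenConvex.abs_div_le (hG : IsEvenConvex G) {b y : ℝ} (hy : |y| ≤ b) :
    |G y / y| ≤ G b / b := by
  rcases eq_or_ne y 0 with rfl | hy0
  · simpa using div_nonneg (hG.nonneg b) ((abs_nonneg _).trans hy)
  have hy1 : 0 < |y| := abs_pos.2 hy0
  have hb : 0 < b := hy1.trans_le hy
  have := hG.smul_le (t := |y| / b) (by positivity) ((div_le_one hb).2 hy) b
  rw [div_mul_cancel₀ _ hb.ne', hG.map_abs] at this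
  rw [abs_div, abs_of_nonneg (hG.nonneg y), div_le_iff₀ hy1]
  calc G y ≤ |y| / b * G b := this
    _ = G b / b * |y| := by ring

/-- The converse Hölder inequality: a density of a functional bounded on the unit ball of `L_{Φ*}`
lies in `L_Φ`. -/
theorem memOrlicz_of_forall_bounded (hΦ : IsYoung Φ) {f : (Ω → ℝ) →ₗ[ℝ] ℝ} {K : ℝ}
    (hK : ∀ ξ ∈ modBall P (conj Φ) 1, |f ξ| ≤ K) {η : Ω → ℝ} (hη : Measurable η)
    (hfη : ∀ (ξ : Ω → ℝ) (B : ℝ), Measurable ξ → (∀ ω, |ξ ω| ≤ B) → f ξ = ∫ ω, ξ ω * η ω ∂P) :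
    MemOrlicz P Φ η := by
  have hE := hΦ.isEvenConvex
  have hE' := hΦ.isEvenConvex_conj
  set c : ℝ := 1 / (2 * max K 1) with hc
  have hK1 : 0 < max K 1 := lt_max_of_lt_right one_pos
  have hc0 : 0 < c := by positivity
  have hmS : ∀ k : ℕ, MeasurableSet {ω | |η ω| ≤ k} := fun k =>
    measurableSet_le hη.abs measurable_const
  have hmΦ : Measurable fun ω => Φ (c * η ω) := hE.measurable.comp (hη.const_mul c)
  have hbound : ∀ k : ℕ, ∫⁻ ω, {ω | |η ω| ≤ k}.indicator
      (fun ω => ENNReal.ofReal (Φ (c * η ω))) ω ∂P ≤ 1 := fun k => by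
    set ξ : Ω → ℝ := {ω | |η ω| ≤ k}.indicator fun ω => Φ (c * η ω) / (c * η ω) with hξ
    have hξm : Measurable ξ := (hmΦ.div (hη.const_mul c)).indicator (hmS k)
    have hξB : ∀ ω, |ξ ω| ≤ Φ (c * k) / (c * k) := fun ω => by
      by_cases hω : |η ω| ≤ k
      · rw [hξ, indicator_of_mem (by exact hω)]
        refine hE.abs_div_le ?_
        rw [abs_mul, abs_of_pos hc0]
        gcongr
      · rw [hξ, indicator_of_notMem (by exact hω), abs_zero]
        exact div_nonneg (hE.nonneg _) (by positivity)
    have hprod : ∀ ω, c * (ξ ω * η ω) = {ω | |η ω| ≤ k}.indicator (fun ω => Φ (c * η ω)) ω := by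
      intro ω
      by_cases hω : |η ω| ≤ k
      · rw [hξ, indicator_of_mem (by exact hω), indicator_of_mem (by exact hω)]
        rcases eq_or_ne (η ω) 0 with h0 | h0
        · simp [h0, hE.map_zero]
        · field_simp
      · rw [hξ, indicator_of_notMem (by exact hω), indicator_of_notMem (by exact hω)]
        simp
    have hpos : ∀ ω, 0 ≤ {ω | |η ω| ≤ k}.indicator (fun ω => Φ (c * η ω)) ω := fun ω =>
      indicator_nonneg (fun _ _ => hE.nonneg _) ω
    have hInt : Integrable ({ω | |η ω| ≤ k}.indicator fun ω => Φ (c * η ω)) P := by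
      refine Integrable.of_bound (hmΦ.indicator (hmS k)).aestronglyMeasurable (Φ (c * k))
        (ae_of_all _ fun ω => ?_)
      rw [Real.norm_eq_abs, abs_of_nonneg (hpos ω)]
      refine indicator_le' (fun ω hω => hE.mono ?_) (fun _ _ => hE.nonneg _) ω
      rw [abs_mul, abs_mul]
      exact mul_le_mul_of_nonneg_left ((mem_ofPred.1 hω).trans (le_abs_self _)) (abs_nonneg _)
    set I : ℝ := ∫ ω, {ω | |η ω| ≤ k}.indicator (fun ω => Φ (c * η ω)) ω ∂P with hI
    have hIf : I = c * f ξ := by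
      rw [hfη ξ _ hξm hξB, ← integral_const_mul]
      exact integral_congr_ae (ae_of_all _ fun ω => (hprod ω).symm)
    have hIl : ∫⁻ ω, {ω | |η ω| ≤ k}.indicator (fun ω => ENNReal.ofReal (Φ (c * η ω))) ω ∂P =
        ENNReal.ofReal I := by
      rw [hI, ofReal_integral_eq_lintegral_ofReal hInt (ae_of_all _ hpos)]
      refine lintegral_congr fun ω => ?_
      by_cases hω : |η ω| ≤ k
      · rw [indicator_of_mem (by exact hω), indicator_of_mem (by exact hω)]
      · rw [indicator_of_notMem (by exact hω), indicator_of_notMem (by exact hω),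
          ENNReal.ofReal_zero]
    set m : ℝ := max I 1 with hm
    have hm1 : 1 ≤ m := le_max_right _ _
    have hm0 : 0 < m := one_pos.trans_le hm1
    have hmem : m⁻¹ • ξ ∈ modBall P (conj Φ) 1 := by
      refine ⟨hξm.const_smul _, ?_⟩
      calc ∫⁻ ω, ENNReal.ofReal (conj Φ ((m⁻¹ • ξ) ω / 1)) ∂P
          ≤ ∫⁻ ω, ENNReal.ofReal m⁻¹ *
              {ω | |η ω| ≤ k}.indicator (fun ω => ENNReal.ofReal (Φ (c * η ω))) ω ∂P := by
            refine lintegral_mono fun ω => ?_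
            by_cases hω : |η ω| ≤ k
            · simp only [hξ, Pi.smul_apply, smul_eq_mul, div_one]
              rw [indicator_of_mem (by exact hω), indicator_of_mem (by exact hω),
                ← ENNReal.ofReal_mul (by positivity)]
              refine ENNReal.ofReal_le_ofReal ?_
              refine (hE'.smul_le (by positivity) (inv_le_one_of_one_le₀ hm1) _).trans ?_
              exact mul_le_mul_of_nonneg_left (hΦ.conj_div_le _) (by positivity)
            · simp only [hξ, Pi.smul_apply, smul_eq_mul, div_one]
              rw [indicator_of_notMem (by exact hω), mul_zero, hE'.map_zero]
              simp
        _ = ENNReal.ofReal (m⁻¹ * I) := by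
            rw [lintegral_const_mul' _ _ ENNReal.ofReal_ne_top, hIl,
              ← ENNReal.ofReal_mul (by positivity)]
        _ ≤ 1 := by
            rw [← ENNReal.ofReal_one]
            refine ENNReal.ofReal_le_ofReal ?_
            rw [inv_mul_le_one₀ hm0]
            exact le_max_left _ _
    have hfle : m⁻¹ * f ξ ≤ max K 1 := by
      have := (le_abs_self _).trans (hK _ hmem)
      rw [map_smul, smul_eq_mul] at this
      exact this.trans (le_max_left _ _)
    rw [inv_mul_le_iff₀ hm0] at hfle
    have hIm : I ≤ m / 2 := by
      rw [hIf]
      refine (mul_le_mul_of_nonneg_left hfle hc0.le).trans_eq ?_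
      rw [hc]
      field_simp
    rw [hIl, ← ENNReal.ofReal_one]
    refine ENNReal.ofReal_le_ofReal ?_
    by_contra! hlt
    rw [hm, max_eq_left hlt.le] at hIm
    linarith
  refine ⟨hη, c, hc0, lt_of_le_of_lt (le_of_tendsto' (lintegral_tendsto_of_tendsto_of_monotone
    (fun k => (hmΦ.ennreal_ofReal.indicator (hmS k)).aemeasurable) (ae_of_all _ fun ω => ?_)
    (ae_of_all _ fun ω => ?_)) hbound) ENNReal.one_lt_top⟩
  · refine fun k j hkj => indicator_le_indicator_of_subset (fun ω hω => ?_) (fun _ => zero_le) ω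
    exact (mem_ofPred.1 hω).trans (by exact_mod_cast hkj)
  · obtain ⟨N, hN⟩ := exists_nat_ge |η ω|
    refine tendsto_const_nhds.congr' ?_
    filter_upwards [eventually_ge_atTop N] with k hk
    rw [indicator_of_mem]
    exact hN.trans (by exact_mod_cast hk)

theorem exists_pairing_eq (hΦ : IsYoung Φ) {f : (Ω → ℝ) →ₗ[ℝ] ℝ}
    (hf : BoundedlyContinuous P (conj Φ) f) {K : ℝ}
    (hK : ∀ ξ ∈ modBall P (conj Φ) 1, |f ξ| ≤ K) :
    ∃ η, MemOrlicz P Φ η ∧ ∀ ξ, MemOrlicz P (conj Φ) ξ → f ξ = pairing P ξ η := by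
  have hG := hΦ.isEvenConvex_conj
  obtain ⟨η, hηm, hηi, hfη⟩ := exists_density hG hf
  have hbdd : ∀ (ξ : Ω → ℝ) (B : ℝ), Measurable ξ → (∀ ω, |ξ ω| ≤ B) →
      f ξ = ∫ ω, ξ ω * η ω ∂P := fun ξ B hξ hB =>
    apply_eq_integral_of_bounded hG hf hηi hfη hξ hB
  have hη := memOrlicz_of_forall_bounded hΦ hK hηm hbdd
  refine ⟨η, hη, fun ξ hξ => ?_⟩
  obtain ⟨l, hl, hξl⟩ := exists_modBall hG hξ
  set ζ : ℕ → Ω → ℝ := fun k => {ω | |ξ ω| ≤ k}.indicator ξ with hζ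
  have hζm : ∀ k, Measurable (ζ k) := fun k =>
    hξ.1.indicator (measurableSet_le hξ.1.abs measurable_const)
  have hζle : ∀ k ω, |ζ k ω| ≤ |ξ ω| := fun k ω => norm_indicator_le_norm_self ξ ω
  have hζB : ∀ (k : ℕ) ω, |ζ k ω| ≤ k := fun k ω => by
    by_cases hω : |ξ ω| ≤ k <;> simp [hζ, hω]
  have hlim : ∀ ω, Tendsto (fun k => ζ k ω) atTop (𝓝 (ξ ω)) := fun ω => by
    obtain ⟨N, hN⟩ := exists_nat_ge |ξ ω|
    refine tendsto_const_nhds.congr' ?_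
    filter_upwards [eventually_ge_atTop N] with k hk
    rw [hζ]
    simp only
    rw [indicator_of_mem]
    exact hN.trans (by exact_mod_cast hk)
  refine tendsto_nhds_unique (hf.tendsto hG hl (ξ := ζ) (fun k => modBall_of_abs_le hG hξl (hζm k)
    fun ω => ?_) hξ.1 (ae_of_all _ hlim)) ?_
  · rw [abs_div, abs_div]
    have := hζle k ω
    gcongr
  · simp only [fun k => hbdd (ζ k) k (hζm k) (hζB k)]
    refine tendsto_integral_of_dominated_convergence _
      (fun k => ((hζm k).mul hηm).aestronglyMeasurable) (integrable_mul hΦ hξ hη).norm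
      (fun k => ae_of_all _ fun ω => ?_) (ae_of_all _ fun ω => (hlim ω).mul_const _)
    rw [norm_mul, norm_mul]
    exact mul_le_mul_of_nonneg_right (hζle k ω) (norm_nonneg _)

end Representation

section Separation

variable {Ω : Type*} [MeasurableSpace Ω] {P : Measure Ω} {Φ : ℝ → ℝ}

theorem modBall_conj_subset_truncPolar (hΦ : IsYoung Φ) {r : ℝ} (hr : 0 < r) (κ : ℕ → ℕ) :
    modBall P (conj Φ) r ⊆ truncPolar P Φ r κ := fun _ hξ => mem_iInter.2 fun i =>
  modBall_conj_subset_truncConj hΦ _ _ (modBall_mono hΦ.isEvenConvex_conj hr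
    (le_mul_of_one_le_right hr.le (by linarith [(Nat.cast_nonneg i : (0 : ℝ) ≤ i)])) hξ)

theorem smul_mem_truncPolar (hΦ : IsYoung Φ) {r : ℝ} (hr : 0 < r) {κ : ℕ → ℕ} {c : ℝ}
    (hc : |c| ≤ 1) {ξ : Ω → ℝ} (hξ : ξ ∈ truncPolar P Φ r κ) : c • ξ ∈ truncPolar P Φ r κ :=
  mem_iInter.2 fun i => by
    have hri : 0 < r * (i + 1) := by positivity
    exact modBall_smul (hΦ.isEvenConvex_truncConj _) hri hri (mul_le_of_le_one_left hri.le hc)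
      (mem_iInter.1 hξ i)

theorem convex_truncPolar (hΦ : IsYoung Φ) {r : ℝ} (hr : 0 < r) (κ : ℕ → ℕ) :
    Convex ℝ (truncPolar P Φ r κ) :=
  convex_iInter fun i => convex_modBall (hΦ.isEvenConvex_truncConj _) (by positivity)

variable [IsProbabilityMeasure P]

theorem eventually_smul_mem_truncPolar (hΦ : IsYoung Φ) {r : ℝ} (hr : 0 < r) (κ : ℕ → ℕ)
    {l : ℝ} (hl : 0 < l) {ξ : ℕ → Ω → ℝ} (hξ : ∀ n, ξ n ∈ modBall P (conj Φ) l)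
    (h : ∀ᵐ ω ∂P, Tendsto (fun n => ξ n ω) atTop (𝓝 0)) (c : ℝ) :
    ∀ᶠ n in atTop, c • ξ n ∈ truncPolar P Φ r κ := by
  have hm : 0 < |c| * l + 1 := by positivity
  have hcξ : ∀ n, c • ξ n ∈ modBall P (conj Φ) (|c| * l + 1) := fun n =>
    modBall_smul hΦ.isEvenConvex_conj hm hl (by linarith) (hξ n)
  have hlim : Tendsto (fun n => ∫⁻ ω, ENNReal.ofReal |c * ξ n ω| ∂P) atTop (𝓝 0) := by
    have := tendsto_lintegral_mul (P := P) hΦ (η := fun _ => 1) measurable_const (by simp) hm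
      hcξ (by
      filter_upwards [h] with ω hω
      simpa using hω.const_mul c)
    simpa using this
  have hsmall : ∀ i, ∀ᶠ n in atTop, c • ξ n ∈ modBall P (truncConj Φ (κ i)) (r * (i + 1)) :=
    fun i => by
      have hri : 0 < r * (i + 1) := by positivity
      have hle : ∀ n, ∫⁻ ω, ENNReal.ofReal (truncConj Φ (κ i) ((c • ξ n) ω / (r * (i + 1)))) ∂P ≤
          ENNReal.ofReal (κ i / (r * (i + 1))) * ∫⁻ ω, ENNReal.ofReal |c * ξ n ω| ∂P := fun n => by
        rw [← lintegral_const_mul' _ _ ENNReal.ofReal_ne_top]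
        refine lintegral_mono fun ω => ?_
        simp only
        rw [← ENNReal.ofReal_mul (by positivity)]
        refine ENNReal.ofReal_le_ofReal ((hΦ.truncConj_le_mul _ _).trans_eq ?_)
        rw [abs_div, abs_of_pos hri, Pi.smul_apply, smul_eq_mul]
        ring
      have hlim' := ENNReal.Tendsto.const_mul (a := ENNReal.ofReal (κ i / (r * (i + 1)))) hlim
        (Or.inr ENNReal.ofReal_ne_top)
      rw [mul_zero] at hlim'
      filter_upwards [hlim'.eventually_lt_const one_pos] with n hn
      exact ⟨(hξ n).1.const_smul c, (hle n).trans hn.le⟩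
  obtain ⟨N, hN⟩ := exists_nat_ge ((|c| * l + 1) / r)
  rw [div_le_iff₀ hr] at hN
  filter_upwards [(Finset.range N).eventually_all.2 fun i _ => hsmall i] with n hn
  refine mem_iInter.2 fun i => ?_
  rcases lt_or_ge i N with hi | hi
  · exact hn i (Finset.mem_range.2 hi)
  · refine modBall_conj_subset_truncConj hΦ _ _
      (modBall_mono hΦ.isEvenConvex_conj hm (hN.trans ?_) (hcξ n))
    rw [mul_comm]
    have : (N : ℝ) ≤ i := by exact_mod_cast hi
    gcongr
    linarith

theorem exists_disjoint_modBall (hΦ : IsYoung Φ) {C : Set (Ω → ℝ)}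
    (hC : BoundedlyClosed P (conj Φ) C) (h0 : (0 : Ω → ℝ) ∉ C) :
    ∃ r, 0 < r ∧ Disjoint C (modBall P (conj Φ) r) := by
  by_contra! hne
  have hex : ∀ j : ℕ, ∃ ξ ∈ C, ξ ∈ modBall P (conj Φ) ((1 / 2) ^ j) := fun j =>
    not_disjoint_iff.1 (hne _ (by positivity))
  choose ξ hξC hξ using hex
  refine h0 (hC 1 ξ 0 one_pos hξC (fun j => modBall_mono hΦ.isEvenConvex_conj (by positivity)
    (pow_le_one₀ (by norm_num) (by norm_num)) (hξ j)) measurable_const ?_)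
  have hsum := ae_summable_of_integral_le (P := P) (T := fun j ω => |ξ j ω|)
    (fun j => (integrable_of_memOrlicz_conj hΦ (memOrlicz_of_modBall (by positivity) (hξ j))).abs)
    (fun j ω => abs_nonneg _) (summable_geometric_two.mul_right (Φ 1 + 1))
    (fun j => (integral_abs_le hΦ (by positivity) (hξ j)).trans_eq (by ring))
  filter_upwards [hsum] with ω hω
  exact tendsto_zero_iff_abs_tendsto_zero _ |>.2 hω.tendsto_atTop_zero

/-- A boundedly closed convex subset of `L_{Φ*}` not containing `0` is separated from `0` by an
element of `L_Φ`. -/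
theorem exists_pairing_ge (hΦ : IsYoung Φ) {C : Set (Ω → ℝ)} (hconv : Convex ℝ C)
    (hC : BoundedlyClosed P (conj Φ) C) (hCE : C ⊆ Orlicz P (conj Φ)) (h0 : (0 : Ω → ℝ) ∉ C) :
    ∃ η u, MemOrlicz P Φ η ∧ 0 < u ∧ ∀ ξ ∈ C, u ≤ pairing P ξ η := by
  have hG := hΦ.isEvenConvex_conj
  obtain ⟨r, hr, hdisj⟩ := exists_disjoint_modBall hΦ hC h0
  obtain ⟨κ, hκ⟩ := exists_disjoint_truncPolar hΦ hconv hC hCE hr hdisj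
  let E := orliczSubmodule P hG
  have hball := modBall_conj_subset_truncPolar (P := P) hΦ hr κ
  have hbal : Balanced ℝ (E.subtype ⁻¹' truncPolar P Φ r κ) := by
    rintro c hc _ ⟨ξ, hξ, rfl⟩
    exact smul_mem_truncPolar hΦ hr hc (mem_preimage.1 hξ)
  have habs : ∀ ξ : E, ∀ᶠ c : ℝ in 𝓝[≠] 0, c • ξ ∈ E.subtype ⁻¹' truncPolar P Φ r κ := by
    intro ξ
    have hξE : MemOrlicz P (conj Φ) ξ := ξ.2
    obtain ⟨l, hl, hξ⟩ := exists_modBall hG hξE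
    have hlim : Tendsto (fun c : ℝ => |c| * l) (𝓝[≠] 0) (𝓝 0) := by
      have : Continuous fun c : ℝ => |c| * l := by fun_prop
      simpa using (this.tendsto 0).mono_left nhdsWithin_le_nhds
    filter_upwards [hlim.eventually_le_const hr] with c hc
    exact hball (modBall_smul hG hr hl hc hξ)
  obtain ⟨f, u, hu, hfV, hfC⟩ := exists_linearMap_of_disjoint hbal
    ((convex_truncPolar hΦ hr κ).linear_preimage E.subtype) habs
    (hconv.linear_preimage E.subtype) (hκ.preimage _)
  obtain ⟨g, hg⟩ := f.exists_extend
  have hgf : ∀ ξ (hξ : ξ ∈ E), g ξ = f ⟨ξ, hξ⟩ := fun ξ hξ => by rw [← hg]; rfl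
  have hgV : ∀ ξ ∈ E, ξ ∈ truncPolar P Φ r κ → |g ξ| ≤ u := fun ξ hξ hξV => by
    rw [hgf ξ hξ]
    exact hfV ⟨ξ, hξ⟩ hξV
  have hgcont : BoundedlyContinuous P (conj Φ) g := by
    intro l ξ hl hξ h
    rw [Metric.tendsto_nhds]
    intro ε hε
    filter_upwards [eventually_smul_mem_truncPolar hΦ hr κ hl hξ h (2 * u / ε)] with n hn
    have := hgV _ (E.smul_mem _ (memOrlicz_of_modBall hl (hξ n))) hn
    rw [map_smul, smul_eq_mul, abs_mul, abs_of_pos (by positivity : 0 < 2 * u / ε),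
      div_mul_eq_mul_div, div_le_iff₀ hε] at this
    rw [Real.dist_eq, sub_zero]
    nlinarith
  have hgK : ∀ ξ ∈ modBall P (conj Φ) 1, |g ξ| ≤ u / r := fun ξ hξ => by
    have := hgV (r • ξ) (E.smul_mem _ (memOrlicz_of_modBall one_pos hξ))
      (hball (modBall_smul hG hr one_pos (by rw [abs_of_pos hr, mul_one]) hξ))
    rw [map_smul, smul_eq_mul, abs_mul, abs_of_pos hr] at this
    rw [le_div_iff₀ hr]
    linarith
  obtain ⟨η, hη, hgη⟩ := exists_pairing_eq hΦ hgcont hgK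
  refine ⟨η, u, hη, hu, fun ξ hξ => ?_⟩
  rw [← hgη ξ (hCE hξ), hgf ξ (hCE hξ)]
  exact hfC ⟨ξ, hCE hξ⟩ hξ

end Separation

/-- For `Φ ∈ Δ₂` and a convex `C ⊆ L_{Φ*}`: weak-star
closedness, sequential weak-star closedness, and closedness in probability on
norm-bounded sets are equivalent. -/
theorem statement4
    {Ω : Type*} [MeasurableSpace Ω] (P : Measure Ω) [IsProbabilityMeasure P]
    (Φ : ℝ → ℝ) (hΦ : IsYoung Φ) (hΔ : Delta2 Φ)
    (C : Set (Ω → ℝ)) (hC : C ⊆ Orlicz P (conj Φ)) (hconv : Convex ℝ C) :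
    ((@IsClosed _ (weakT P (Orlicz P (conj Φ)) (Orlicz P Φ))
        {ξ : Orlicz P (conj Φ) | ↑ξ ∈ C}) ↔
      (∀ (ξ : ℕ → Orlicz P (conj Φ)) (ξ₀ : Orlicz P (conj Φ)),
        (∀ n, ↑(ξ n) ∈ C) →
        Tendsto ξ atTop (@nhds _ (weakT P (Orlicz P (conj Φ)) (Orlicz P Φ)) ξ₀) →
        ↑ξ₀ ∈ C)) ∧
    ((@IsClosed _ (weakT P (Orlicz P (conj Φ)) (Orlicz P Φ))
        {ξ : Orlicz P (conj Φ) | ↑ξ ∈ C}) ↔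
      (∀ (ξ : ℕ → Ω → ℝ) (ξ₀ : Ω → ℝ), (∀ n, ξ n ∈ C) → Measurable ξ₀ →
        (∃ M : ℝ, ∀ n, luxNorm P (conj Φ) (ξ n) ≤ M) →
        TendstoInMeasure P ξ atTop ξ₀ → ξ₀ ∈ C)) := by
  have hG := hΦ.isEvenConvex_conj
  let _ : TopologicalSpace (Orlicz P (conj Φ)) := weakT P (Orlicz P (conj Φ)) (Orlicz P Φ)
  have hind : IsInducing fun (ξ : Orlicz P (conj Φ)) (η : Orlicz P Φ) =>
      pairing P (ξ : Ω → ℝ) (η : Ω → ℝ) := ⟨rfl⟩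
  have closed_seq : IsClosed {ξ : Orlicz P (conj Φ) | ↑ξ ∈ C} →
      ∀ (ξ : ℕ → Orlicz P (conj Φ)) (ξ₀ : Orlicz P (conj Φ)), (∀ n, ↑(ξ n) ∈ C) →
        Tendsto ξ atTop (𝓝 ξ₀) → ↑ξ₀ ∈ C := fun h ξ ξ₀ hξ hlim =>
    h.mem_of_tendsto hlim (Eventually.of_forall hξ)
  have seq_prob : (∀ (ξ : ℕ → Orlicz P (conj Φ)) (ξ₀ : Orlicz P (conj Φ)), (∀ n, ↑(ξ n) ∈ C) →
        Tendsto ξ atTop (𝓝 ξ₀) → ↑ξ₀ ∈ C) →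
      ∀ (ξ : ℕ → Ω → ℝ) (ξ₀ : Ω → ℝ), (∀ n, ξ n ∈ C) → Measurable ξ₀ →
        (∃ M : ℝ, ∀ n, luxNorm P (conj Φ) (ξ n) ≤ M) →
        TendstoInMeasure P ξ atTop ξ₀ → ξ₀ ∈ C := by
    rintro h ξ ξ₀ hξ hξ₀ ⟨M, hM⟩ hlim
    obtain ⟨φ, -, hφ⟩ := hlim.exists_seq_tendsto_ae
    have hl : 0 < max M 0 + 1 := by positivity
    have hball : ∀ n, ξ (φ n) ∈ modBall P (conj Φ) (max M 0 + 1) := fun n =>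
      modBall_of_luxNorm_lt hG (hC (hξ _)) (by linarith [hM (φ n), le_max_left M 0])
    refine h (fun n => ⟨ξ (φ n), hC (hξ _)⟩)
      ⟨ξ₀, memOrlicz_of_modBall hl (modBall_of_tendsto hG hball hξ₀ hφ)⟩ (fun n => hξ _) ?_
    exact hind.tendsto_nhds_iff.2 (tendsto_pi_nhds.2 fun η =>
      tendsto_pairing hΦ η.2.1 (hΔ.lintegral_lt_top hΦ η.2) hl hball hξ₀ hφ)
  have prob_closed : (∀ (ξ : ℕ → Ω → ℝ) (ξ₀ : Ω → ℝ), (∀ n, ξ n ∈ C) → Measurable ξ₀ →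
        (∃ M : ℝ, ∀ n, luxNorm P (conj Φ) (ξ n) ≤ M) →
        TendstoInMeasure P ξ atTop ξ₀ → ξ₀ ∈ C) →
      IsClosed {ξ : Orlicz P (conj Φ) | ↑ξ ∈ C} := by
    intro h
    refine isOpen_compl_iff.1 (isOpen_iff_forall_mem_open.2 fun ξ₀ hξ₀ => ?_)
    obtain ⟨m, hm, hξ₀m⟩ := exists_modBall hG ξ₀.2
    have hsub : (fun ζ => ζ + ξ₀.1) ⁻¹' C ⊆ Orlicz P (conj Φ) := fun ζ hζ => by
      have := (orliczSubmodule P hG).sub_mem (hC hζ) ξ₀.2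
      rwa [add_sub_cancel_right] at this
    have hbc : BoundedlyClosed P (conj Φ) ((fun ζ => ζ + ξ₀.1) ⁻¹' C) := by
      intro l ζ ζ₀ hl hζ hζl hζ₀ hlim
      refine h (fun n => ζ n + ξ₀.1) (ζ₀ + ξ₀.1) hζ (hζ₀.add ξ₀.2.1) ⟨l + m, fun n =>
        luxNorm_le (add_pos hl hm) (modBall_add hG hl hm (hζl n) hξ₀m)⟩ ?_
      refine tendstoInMeasure_of_tendsto_ae
        (fun n => ((hζl n).1.add ξ₀.2.1).aestronglyMeasurable) ?_
      filter_upwards [hlim] with ω hω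
      exact hω.add_const _
    obtain ⟨η, u, hη, hu, hle⟩ := exists_pairing_ge hΦ (hconv.translate_preimage_left ξ₀.1) hbc hsub
      (by simpa using hξ₀)
    have hcont : Continuous fun ξ : Orlicz P (conj Φ) => pairing P (ξ : Ω → ℝ) η :=
      (continuous_apply (⟨η, hη⟩ : Orlicz P Φ)).comp hind.continuous
    refine ⟨{ξ | pairing P (ξ : Ω → ℝ) η < pairing P (ξ₀ : Ω → ℝ) η + u}, fun ξ hξ hξC => ?_,
      isOpen_lt hcont continuous_const, lt_add_of_pos_right _ hu⟩
    have h1 := hle (ξ.1 - ξ₀.1) (by simpa using hξC)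
    have h2 : pairing P (ξ.1 - ξ₀.1) η = pairing P ξ.1 η - pairing P ξ₀.1 η := by
      simp only [pairing, Pi.sub_apply, sub_mul]
      exact integral_sub (integrable_mul hΦ ξ.2 hη) (integrable_mul hΦ ξ₀.2 hη)
    rw [h2] at h1
    have h3 : pairing P ξ.1 η < pairing P ξ₀.1 η + u := hξ
    linarith
  exact ⟨⟨closed_seq, fun h => prob_closed (seq_prob h)⟩, ⟨fun h => seq_prob (closed_seq h),
    prob_closed⟩⟩

end OrliczPaper
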